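/- arXiv:1312.2933 — 2 statements merged into one kernel-verified Lean document; each statement's English description precedes it below -/
import Mathlib

section
/- Let (f,g,ρ) be a warped Berger solution of Ricci flow on S^1×S^3 defined on [0,T) satisfying Assumption A. Then the singularity at time T is Type-I: there exist constants c > 0 and C < ∞ such that c·√(T−t) ≤ M̌(t) ≤ C·√(T−t) for all t ∈ [0,T), and all sectional curvatures satisfy |κ_{01}(ξ,t)| + 2|κ_{02}(ξ,t)| + 2|κ_{12}(ξ,t)| + |κ_{23}(ξ,t)| ≤ C/(T−t) for all (ξ,t) ∈ S^1×[0,T). -/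
open Real Set Filter Topology

noncomputable section

/-- Partial derivative in the first (spatial, `ξ`) variable. -/
def pd1 (φ : ℝ → ℝ → ℝ) (ξ t : ℝ) : ℝ := deriv (fun x => φ x t) ξ

/-- Partial derivative in the second (time) variable: `φ_t`. -/
def pdt (φ : ℝ → ℝ → ℝ) (ξ t : ℝ) : ℝ := deriv (fun τ => φ ξ τ) t

/-- Derivative with respect to arclength `s` (where `ds = ρ dξ`): `φ_s := ρ⁻¹ ∂_ξ φ`. -/
def Ds (ρ φ : ℝ → ℝ → ℝ) (ξ t : ℝ) : ℝ := pd1 φ ξ t / ρ ξ t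

/-- Sectional curvature `κ₁₂ = κ₃₁ = f²/g⁴ − f_s g_s/(f g)`. -/
def k12 (ρ f g : ℝ → ℝ → ℝ) (ξ t : ℝ) : ℝ :=
  (f ξ t) ^ 2 / (g ξ t) ^ 4 - Ds ρ f ξ t * Ds ρ g ξ t / (f ξ t * g ξ t)

/-- Sectional curvature `κ₃₁ = κ₁₂`. -/
def k31 (ρ f g : ℝ → ℝ → ℝ) (ξ t : ℝ) : ℝ :=
  (f ξ t) ^ 2 / (g ξ t) ^ 4 - Ds ρ f ξ t * Ds ρ g ξ t / (f ξ t * g ξ t)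

/-- Sectional curvature `κ₂₃ = (4g² − 3f²)/g⁴ − g_s²/g²`. -/
def k23 (ρ f g : ℝ → ℝ → ℝ) (ξ t : ℝ) : ℝ :=
  (4 * (g ξ t) ^ 2 - 3 * (f ξ t) ^ 2) / (g ξ t) ^ 4 - (Ds ρ g ξ t) ^ 2 / (g ξ t) ^ 2

/-- Sectional curvature `κ₀₁ = −f_ss/f`. -/
def k01 (ρ f : ℝ → ℝ → ℝ) (ξ t : ℝ) : ℝ := -(Ds ρ (Ds ρ f) ξ t) / f ξ t

/-- Sectional curvature `κ₀₂ = κ₀₃ = −g_ss/g`. -/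
def k02 (ρ g : ℝ → ℝ → ℝ) (ξ t : ℝ) : ℝ := -(Ds ρ (Ds ρ g) ξ t) / g ξ t

/-- Scalar curvature `R = κ₀₁ + 2κ₀₂ + 2κ₁₂ + κ₂₃`. -/
def scalR (ρ f g : ℝ → ℝ → ℝ) (ξ t : ℝ) : ℝ :=
  k01 ρ f ξ t + 2 * k02 ρ g ξ t + 2 * k12 ρ f g ξ t + k23 ρ f g ξ t

/-- `M(ξ,t) := min {f(ξ,t), g(ξ,t)}`. -/
def M (f g : ℝ → ℝ → ℝ) (ξ t : ℝ) : ℝ := min (f ξ t) (g ξ t)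

/-- `M̌(t) := min_{ξ ∈ S¹} M(ξ,t)`. -/
def Mcheck (f g : ℝ → ℝ → ℝ) (t : ℝ) : ℝ := ⨅ ξ : ℝ, M f g ξ t

/-- A warped Berger solution of Ricci flow on `S¹ × S³` with (finite) existence time `T`:
smooth positive `2π`-periodic-in-`ξ` functions `f, g, ρ` on `S¹ × [0,T)` satisfying
  `f_t = f_ss + 2 (g_s/g) f_s − 2 f³/g⁴`,
  `g_t = g_ss + (f_s/f + g_s/g) g_s + 2 (f² − 2g²)/g³`,
  `(log ρ)_t = f_ss/f + 2 g_ss/g`. -/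
structure WarpedBerger (T : ℝ) (f g ρ : ℝ → ℝ → ℝ) : Prop where
  T_pos : 0 < T
  f_pos : ∀ ξ t : ℝ, 0 ≤ t → t < T → 0 < f ξ t
  g_pos : ∀ ξ t : ℝ, 0 ≤ t → t < T → 0 < g ξ t
  ρ_pos : ∀ ξ t : ℝ, 0 ≤ t → t < T → 0 < ρ ξ t
  f_per : ∀ ξ t : ℝ, f (ξ + 2 * π) t = f ξ t
  g_per : ∀ ξ t : ℝ, g (ξ + 2 * π) t = g ξ t
  ρ_per : ∀ ξ t : ℝ, ρ (ξ + 2 * π) t = ρ ξ t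
  smooth : ContDiffOn ℝ (⊤ : ℕ∞)
      (fun p : ℝ × ℝ => (f p.1 p.2, g p.1 p.2, ρ p.1 p.2)) (Set.univ ×ˢ Set.Ico 0 T)
  eq_f : ∀ ξ t : ℝ, 0 < t → t < T →
    pdt f ξ t = Ds ρ (Ds ρ f) ξ t + 2 * (Ds ρ g ξ t / g ξ t) * Ds ρ f ξ t
      - 2 * (f ξ t) ^ 3 / (g ξ t) ^ 4
  eq_g : ∀ ξ t : ℝ, 0 < t → t < T →
    pdt g ξ t = Ds ρ (Ds ρ g) ξ t
      + (Ds ρ f ξ t / f ξ t + Ds ρ g ξ t / g ξ t) * Ds ρ g ξ t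
      + 2 * ((f ξ t) ^ 2 - 2 * (g ξ t) ^ 2) / (g ξ t) ^ 3
  eq_ρ : ∀ ξ t : ℝ, 0 < t → t < T →
    pdt (fun x τ => Real.log (ρ x τ)) ξ t
      = Ds ρ (Ds ρ f) ξ t / f ξ t + 2 * (Ds ρ (Ds ρ g) ξ t / g ξ t)

/-- The Ricci curvature blows up as `t ↗ T`:
`limsup_{t↗T} max_ξ (|κ₀₁+2κ₁₂| + |κ₀₁+2κ₀₂| + |κ₀₂+κ₁₂+κ₂₃|) = ∞`, where the three
displayed quantities are the diagonal components of the Ricci tensor. -/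
def RicciBlowup (T : ℝ) (f g ρ : ℝ → ℝ → ℝ) : Prop :=
  ∀ K : ℝ, ∀ t₀ : ℝ, 0 ≤ t₀ → t₀ < T → ∃ ξ t : ℝ, t₀ < t ∧ t < T ∧
    K < |k01 ρ f ξ t + 2 * k12 ρ f g ξ t| + |k01 ρ f ξ t + 2 * k02 ρ g ξ t|
        + |k02 ρ g ξ t + k12 ρ f g ξ t + k23 ρ f g ξ t|

/-- Assumption A: `f ≤ g` at `t = 0`; `(min_ξ R(ξ,0))·(max_ξ g(ξ,0)²) > −3`;
and the Ricci curvature blows up at the finite time `T`. -/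
structure AssumptionA (T : ℝ) (f g ρ : ℝ → ℝ → ℝ) extends WarpedBerger T f g ρ : Prop where
  init_order : ∀ ξ : ℝ, f ξ 0 ≤ g ξ 0
  init_scalar : (⨅ ξ : ℝ, scalR ρ f g ξ 0) * (⨆ ξ : ℝ, (g ξ 0) ^ 2) > -3
  ricci_blowup : RicciBlowup T f g ρ

set_option linter.unusedVariables false
set_option linter.unusedSimpArgs false

namespace WB

/-- Smooth periodic functions. -/
def Sm (T : ℝ) (φ : ℝ → ℝ → ℝ) : Prop :=
  ContDiffOn ℝ (⊤ : ℕ∞) (fun p : ℝ × ℝ => φ p.1 p.2) (Set.univ ×ˢ Set.Ico 0 T) ∧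
    ∀ ξ t : ℝ, φ (ξ + 2 * π) t = φ ξ t

def Ex (φ : ℝ → ℝ → ℝ) : ℝ → ℝ → ℝ := fun ξ t => Real.exp (φ ξ t)

theorem Ex_apply (φ : ℝ → ℝ → ℝ) (ξ t : ℝ) : Ex φ ξ t = Real.exp (φ ξ t) := rfl

variable {T : ℝ} {φ ψ : ℝ → ℝ → ℝ}

theorem Sm.add (h : Sm T φ) (k : Sm T ψ) : Sm T (φ + ψ) :=
  ⟨h.1.add k.1, fun ξ t => by simp [h.2, k.2]⟩
theorem Sm.sub (h : Sm T φ) (k : Sm T ψ) : Sm T (φ - ψ) :=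
  ⟨h.1.sub k.1, fun ξ t => by simp [h.2, k.2]⟩
theorem Sm.mul (h : Sm T φ) (k : Sm T ψ) : Sm T (φ * ψ) :=
  ⟨h.1.mul k.1, fun ξ t => by simp [h.2, k.2]⟩
theorem Sm.smul (h : Sm T φ) (c : ℝ) : Sm T (c • φ) :=
  ⟨h.1.const_smul c, fun ξ t => by simp [h.2]⟩
theorem Sm.neg (h : Sm T φ) : Sm T (-φ) :=
  ⟨h.1.neg, fun ξ t => by simp [h.2]⟩
theorem Sm.ex (h : Sm T φ) : Sm T (Ex φ) :=
  ⟨h.1.exp, fun ξ t => by simp [Ex, h.2]⟩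

theorem ud (T : ℝ) : UniqueDiffOn ℝ ((Set.univ : Set ℝ) ×ˢ Set.Ico 0 T) :=
  uniqueDiffOn_univ.prod (uniqueDiffOn_Ico 0 T)

theorem Sm.hasDeriv1 (h : Sm T φ) {ξ t : ℝ} (h0 : 0 ≤ t) (h1 : t < T) :
    HasDerivAt (fun x => φ x t)
      (fderivWithin ℝ (fun p : ℝ × ℝ => φ p.1 p.2) (Set.univ ×ˢ Set.Ico 0 T) (ξ, t) (1, 0)) ξ := by
  have hd := (h.1.differentiableOn (by simp) (ξ, t) ⟨trivial, h0, h1⟩).hasFDerivWithinAt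
  have hl : HasDerivWithinAt (fun x : ℝ => (x, t)) (1, 0) Set.univ ξ :=
    ((hasDerivAt_id ξ).prodMk (hasDerivAt_const ξ t)).hasDerivWithinAt
  have := hd.comp_hasDerivWithinAt (x := ξ) (f := fun x : ℝ => (x, t)) hl
    (fun x _ => ⟨trivial, h0, h1⟩)
  rwa [hasDerivWithinAt_univ] at this

theorem Sm.pd1 (h : Sm T φ) : Sm T (pd1 φ) := by
  constructor
  · have := (h.1.fderivWithin (ud T) (m := (⊤ : ℕ∞)) (by simp)).clm_apply
      (contDiffOn_const (c := ((1 : ℝ), (0 : ℝ))))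
    refine this.congr ?_
    rintro ⟨ξ, t⟩ ⟨_, h0, h1⟩
    exact (h.hasDeriv1 h0 h1).deriv
  · intro ξ t
    unfold _root_.pd1
    rw [← deriv_comp_add_const]
    simp [h.2]

theorem Sm.diff1 (h : Sm T φ) {ξ t : ℝ} (h0 : 0 ≤ t) (h1 : t < T) :
    DifferentiableAt ℝ (fun x => φ x t) ξ := (h.hasDeriv1 h0 h1).differentiableAt

theorem Sm.hasPd1 (h : Sm T φ) {ξ t : ℝ} (h0 : 0 ≤ t) (h1 : t < T) :
    HasDerivAt (fun x => φ x t) (_root_.pd1 φ ξ t) ξ := (h.diff1 h0 h1).hasDerivAt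

theorem Sm.cda (h : Sm T φ) {ξ t : ℝ} (h0 : 0 < t) (h1 : t < T) :
    ContDiffAt ℝ (⊤ : ℕ∞) (fun p : ℝ × ℝ => φ p.1 p.2) (ξ, t) :=
  h.1.contDiffAt (prod_mem_nhds univ_mem (Ico_mem_nhds h0 h1))

theorem Sm.hasPdt' (h : Sm T φ) {ξ t : ℝ} (h0 : 0 < t) (h1 : t < T) :
    HasDerivAt (fun τ => φ ξ τ) (fderiv ℝ (fun p : ℝ × ℝ => φ p.1 p.2) (ξ, t) (0, 1)) t := by
  have hd := ((h.cda (ξ := ξ) h0 h1).differentiableAt (by simp)).hasFDerivAt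
  exact hd.comp_hasDerivAt (x := t) (f := fun x : ℝ => (ξ, x))
    ((hasDerivAt_const t ξ).prodMk (hasDerivAt_id t))

theorem Sm.hasPdt (h : Sm T φ) {ξ t : ℝ} (h0 : 0 < t) (h1 : t < T) :
    HasDerivAt (fun τ => φ ξ τ) (pdt φ ξ t) t := (h.hasPdt' h0 h1).differentiableAt.hasDerivAt

theorem Sm.pd1_eq (h : Sm T φ) {ξ t : ℝ} (h0 : 0 < t) (h1 : t < T) :
    _root_.pd1 φ ξ t = fderiv ℝ (fun p : ℝ × ℝ => φ p.1 p.2) (ξ, t) (1, 0) := by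
  have hd := ((h.cda (ξ := ξ) h0 h1).differentiableAt (by simp)).hasFDerivAt
  exact (hd.comp_hasDerivAt (x := ξ) (f := fun x : ℝ => (x, t))
    ((hasDerivAt_id ξ).prodMk (hasDerivAt_const ξ t))).deriv

theorem Sm.pdt_eq (h : Sm T φ) {ξ t : ℝ} (h0 : 0 < t) (h1 : t < T) :
    pdt φ ξ t = fderiv ℝ (fun p : ℝ × ℝ => φ p.1 p.2) (ξ, t) (0, 1) := (h.hasPdt' h0 h1).deriv

/-- Mixed partial derivatives commute. -/
theorem Sm.comm (h : Sm T φ) {ξ t : ℝ} (h0 : 0 < t) (h1 : t < T) :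
    HasDerivAt (fun x => pdt φ x t) (pdt (_root_.pd1 φ) ξ t) ξ := by
  set F := (fun p : ℝ × ℝ => φ p.1 p.2) with hF
  have hc := h.cda (ξ := ξ) h0 h1
  have hs : IsSymmSndFDerivAt ℝ F (ξ, t) := hc.isSymmSndFDerivAt (by
    simp only [minSmoothness_of_isRCLikeNormedField]
    exact WithTop.coe_le_coe.2 (le_top : (2 : ℕ∞) ≤ ⊤))
  have hd : HasFDerivAt (fderiv ℝ F) (fderiv ℝ (fderiv ℝ F) (ξ, t)) (ξ, t) :=
    ((hc.fderiv_right (m := 1) (by norm_cast)).differentiableAt (by simp)).hasFDerivAt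
  have e1 : HasDerivAt (fun x => fderiv ℝ F (x, t) (0, 1))
      (fderiv ℝ (fderiv ℝ F) (ξ, t) (1, 0) (0, 1)) ξ := by
    have := hd.comp_hasDerivAt (x := ξ) (f := fun x : ℝ => (x, t))
      ((hasDerivAt_id ξ).prodMk (hasDerivAt_const ξ t))
    simpa using this.clm_apply (hasDerivAt_const ξ ((0 : ℝ), (1 : ℝ)))
  have e2 : HasDerivAt (fun x => fderiv ℝ F (ξ, x) (1, 0))
      (fderiv ℝ (fderiv ℝ F) (ξ, t) (0, 1) (1, 0)) t := by
    have := hd.comp_hasDerivAt (x := t) (f := fun x : ℝ => (ξ, x))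
      ((hasDerivAt_const t ξ).prodMk (hasDerivAt_id t))
    simpa using this.clm_apply (hasDerivAt_const t ((1 : ℝ), (0 : ℝ)))
  have e3 : pdt (_root_.pd1 φ) ξ t = fderiv ℝ (fderiv ℝ F) (ξ, t) (0, 1) (1, 0) := by
    rw [← e2.deriv]
    apply Filter.EventuallyEq.deriv_eq
    filter_upwards [Ioo_mem_nhds h0 h1] with τ hτ
    exact h.pd1_eq hτ.1 hτ.2
  rw [e3, hs.eq (0, 1) (1, 0)]
  exact e1.congr_of_eventuallyEq (Filter.Eventually.of_forall fun x => h.pdt_eq h0 h1)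

/-- The heat operator. -/
def L (ρ u v φ : ℝ → ℝ → ℝ) (ξ t : ℝ) : ℝ :=
  pdt φ ξ t - Ds ρ (Ds ρ φ) ξ t - (Ds ρ u ξ t + 2 * Ds ρ v ξ t) * Ds ρ φ ξ t

structure Flow (T : ℝ) (ρ u v : ℝ → ℝ → ℝ) : Prop where
  T_pos : 0 < T
  su : Sm T u
  sv : Sm T v
  sρ : Sm T ρ
  ρ_pos : ∀ ξ t : ℝ, 0 ≤ t → t < T → 0 < ρ ξ t
  Lu : ∀ ξ t : ℝ, 0 < t → t < T → L ρ u v u ξ t = -2 * Real.exp (2 * u ξ t + -4 * v ξ t)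
  Lv : ∀ ξ t : ℝ, 0 < t → t < T →
    L ρ u v v ξ t = 2 * Real.exp (2 * u ξ t + -4 * v ξ t) - 4 * Real.exp (-2 * v ξ t)
  hρ : ∀ ξ t : ℝ, 0 < t → t < T → pdt ρ ξ t =
    ρ ξ t * (Ds ρ (Ds ρ u) ξ t + Ds ρ u ξ t ^ 2 + 2 * (Ds ρ (Ds ρ v) ξ t + Ds ρ v ξ t ^ 2))

variable {ρ u v : ℝ → ℝ → ℝ}

namespace Flow

theorem sD (F : Flow T ρ u v) (h : Sm T φ) : Sm T (Ds ρ φ) := by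
  refine ⟨h.pd1.1.div F.sρ.1 ?_, fun ξ t => ?_⟩
  · rintro ⟨ξ, t⟩ ⟨_, h0, h1⟩
    exact (F.ρ_pos ξ t h0 h1).ne'
  · simp [Ds, h.pd1.2, F.sρ.2]

section space
variable {ξ t : ℝ}
theorem D_add (F : Flow T ρ u v) (h0 : 0 < t) (h1 : t < T) (h : Sm T φ) (k : Sm T ψ) :
    Ds ρ (φ + ψ) ξ t = Ds ρ φ ξ t + Ds ρ ψ ξ t := by
  have : pd1 (φ + ψ) ξ t = _ := ((h.hasPd1 h0.le h1).add (k.hasPd1 h0.le h1)).deriv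
  simp only [Ds, this, add_div]
theorem D_sub (F : Flow T ρ u v) (h0 : 0 < t) (h1 : t < T) (h : Sm T φ) (k : Sm T ψ) :
    Ds ρ (φ - ψ) ξ t = Ds ρ φ ξ t - Ds ρ ψ ξ t := by
  have : pd1 (φ - ψ) ξ t = _ := ((h.hasPd1 h0.le h1).sub (k.hasPd1 h0.le h1)).deriv
  simp only [Ds, this, sub_div]
theorem D_neg (F : Flow T ρ u v) (h0 : 0 < t) (h1 : t < T) (h : Sm T φ) :
    Ds ρ (-φ) ξ t = -Ds ρ φ ξ t := by
  have : pd1 (-φ) ξ t = _ := (h.hasPd1 h0.le h1).neg.deriv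
  simp only [Ds, this, neg_div]
theorem D_smul (F : Flow T ρ u v) (h0 : 0 < t) (h1 : t < T) (h : Sm T φ) (c : ℝ) :
    Ds ρ (c • φ) ξ t = c * Ds ρ φ ξ t := by
  have : pd1 (c • φ) ξ t = _ := ((h.hasPd1 h0.le h1).const_smul c).deriv
  simp only [Ds, this, smul_eq_mul, mul_div_assoc]
theorem D_mul (F : Flow T ρ u v) (h0 : 0 < t) (h1 : t < T) (h : Sm T φ) (k : Sm T ψ) :
    Ds ρ (φ * ψ) ξ t = Ds ρ φ ξ t * ψ ξ t + φ ξ t * Ds ρ ψ ξ t := by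
  have : pd1 (φ * ψ) ξ t = _ := ((h.hasPd1 h0.le h1).mul (k.hasPd1 h0.le h1)).deriv
  simp only [Ds, this]; ring
theorem D_ex (F : Flow T ρ u v) (h0 : 0 < t) (h1 : t < T) (h : Sm T φ) :
    Ds ρ (Ex φ) ξ t = Real.exp (φ ξ t) * Ds ρ φ ξ t := by
  have : pd1 (Ex φ) ξ t = _ := (h.hasPd1 h0.le h1).exp.deriv
  simp only [Ds, this]; ring
theorem D_congr (h : ∀ x, φ x t = ψ x t) : Ds ρ φ ξ t = Ds ρ ψ ξ t := by
  simp only [Ds, pd1, h]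

theorem L_add (F : Flow T ρ u v) (h0 : 0 < t) (h1 : t < T) (h : Sm T φ) (k : Sm T ψ) :
    L ρ u v (φ + ψ) ξ t = L ρ u v φ ξ t + L ρ u v ψ ξ t := by
  have e : pdt (φ + ψ) ξ t = _ := ((h.hasPdt h0 h1).add (k.hasPdt h0 h1)).deriv
  have e2 : Ds ρ (Ds ρ (φ + ψ)) ξ t = Ds ρ (Ds ρ φ + Ds ρ ψ) ξ t :=
    D_congr fun x => F.D_add h0 h1 h k
  simp only [L, e, e2, F.D_add h0 h1 h k, F.D_add h0 h1 (F.sD h) (F.sD k)]; ring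
theorem L_smul (F : Flow T ρ u v) (h0 : 0 < t) (h1 : t < T) (h : Sm T φ) (c : ℝ) :
    L ρ u v (c • φ) ξ t = c * L ρ u v φ ξ t := by
  have e : pdt (c • φ) ξ t = _ := ((h.hasPdt h0 h1).const_smul c).deriv
  have e2 : Ds ρ (Ds ρ (c • φ)) ξ t = Ds ρ (c • Ds ρ φ) ξ t :=
    D_congr fun x => F.D_smul h0 h1 h c
  simp only [L, e, e2, F.D_smul h0 h1 h, F.D_smul h0 h1 (F.sD h), smul_eq_mul]; ring
theorem L_neg (F : Flow T ρ u v) (h0 : 0 < t) (h1 : t < T) (h : Sm T φ) :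
    L ρ u v (-φ) ξ t = - L ρ u v φ ξ t := by
  have := F.L_smul (ξ := ξ) h0 h1 h (-1)
  simpa using this
theorem L_sub (F : Flow T ρ u v) (h0 : 0 < t) (h1 : t < T) (h : Sm T φ) (k : Sm T ψ) :
    L ρ u v (φ - ψ) ξ t = L ρ u v φ ξ t - L ρ u v ψ ξ t := by
  rw [sub_eq_add_neg, F.L_add h0 h1 h k.neg, F.L_neg h0 h1 k]; ring
theorem L_mul (F : Flow T ρ u v) (h0 : 0 < t) (h1 : t < T) (h : Sm T φ) (k : Sm T ψ) :
    L ρ u v (φ * ψ) ξ t = L ρ u v φ ξ t * ψ ξ t + φ ξ t * L ρ u v ψ ξ t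
      - 2 * Ds ρ φ ξ t * Ds ρ ψ ξ t := by
  have e : pdt (φ * ψ) ξ t = _ := ((h.hasPdt h0 h1).mul (k.hasPdt h0 h1)).deriv
  have e2 : Ds ρ (Ds ρ (φ * ψ)) ξ t = Ds ρ (Ds ρ φ * ψ + φ * Ds ρ ψ) ξ t :=
    D_congr fun x => F.D_mul h0 h1 h k
  rw [F.D_add h0 h1 ((F.sD h).mul k) (h.mul (F.sD k)), F.D_mul h0 h1 (F.sD h) k,
    F.D_mul h0 h1 h (F.sD k)] at e2
  simp only [L, e, e2, F.D_mul h0 h1 h k]; ring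
theorem L_ex (F : Flow T ρ u v) (h0 : 0 < t) (h1 : t < T) (h : Sm T φ) :
    L ρ u v (Ex φ) ξ t = Real.exp (φ ξ t) * (L ρ u v φ ξ t - Ds ρ φ ξ t ^ 2) := by
  have e : pdt (Ex φ) ξ t = _ := (h.hasPdt h0 h1).exp.deriv
  have e2 : Ds ρ (Ds ρ (Ex φ)) ξ t = Ds ρ (Ex φ * Ds ρ φ) ξ t :=
    D_congr fun x => F.D_ex h0 h1 h
  rw [F.D_mul h0 h1 h.ex (F.sD h), F.D_ex h0 h1 h] at e2
  simp only [L, e, e2, F.D_ex h0 h1 h, Ex_apply]; ring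

/-- The commutator formula. -/
theorem L_D (F : Flow T ρ u v) (h0 : 0 < t) (h1 : t < T) (h : Sm T φ) :
    L ρ u v (Ds ρ φ) ξ t = Ds ρ (L ρ u v φ) ξ t
      - (Ds ρ u ξ t ^ 2 + 2 * Ds ρ v ξ t ^ 2) * Ds ρ φ ξ t := by
  have hr := (F.ρ_pos ξ t h0.le h1).ne'
  have e : pdt (Ds ρ φ) ξ t = _ := ((h.pd1.hasPdt h0 h1).div (F.sρ.hasPdt h0 h1) hr).deriv
  have su := F.sD F.su
  have sv := F.sD F.sv
  have sp := F.sD h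
  set W := Ds ρ (Ds ρ φ) + (Ds ρ u + (2 : ℝ) • Ds ρ v) * Ds ρ φ with hW
  have sW : Sm T W := (F.sD sp).add ((su.add (sv.smul 2)).mul sp)
  have hL : HasDerivAt (fun x => L ρ u v φ x t) (pdt (pd1 φ) ξ t - pd1 W ξ t) ξ := by
    refine ((h.comm h0 h1).sub (sW.hasPd1 h0.le h1)).congr_of_eventuallyEq
      (Filter.Eventually.of_forall fun x => ?_)
    simp [L, hW]; ring
  have e2 : Ds ρ (L ρ u v φ) ξ t = pdt (pd1 φ) ξ t / ρ ξ t - Ds ρ W ξ t := by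
    rw [Ds, pd1, hL.deriv, sub_div]; rfl
  have e3 : Ds ρ W ξ t = Ds ρ (Ds ρ (Ds ρ φ)) ξ t +
      ((Ds ρ (Ds ρ u) ξ t + 2 * Ds ρ (Ds ρ v) ξ t) * Ds ρ φ ξ t +
        (Ds ρ u ξ t + 2 * Ds ρ v ξ t) * Ds ρ (Ds ρ φ) ξ t) := by
    rw [hW, F.D_add h0 h1 (F.sD sp) ((su.add (sv.smul 2)).mul sp),
      F.D_mul h0 h1 (su.add (sv.smul 2)) sp, F.D_add h0 h1 su (sv.smul 2), F.D_smul h0 h1 sv]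
    simp
  have e4 : pd1 φ ξ t = ρ ξ t * Ds ρ φ ξ t := by rw [Ds]; field_simp
  rw [e2, e3, L, e, F.hρ ξ t h0 h1, e4]
  field_simp
  ring

end space
end Flow

theorem Sm.contOn (h : Sm T φ) :
    ContinuousOn (fun p : ℝ × ℝ => φ p.1 p.2) (Set.univ ×ˢ Set.Ico 0 T) := h.1.continuousOn

theorem Sm.per (h : Sm T φ) (t ξ : ℝ) : ∃ x ∈ Set.Icc 0 (2 * π), ∀ s, φ ξ s = φ x s := by
  have hp : Function.Periodic (fun x => φ x) (2 * π) := fun x => funext fun s => h.2 x s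
  obtain ⟨x, hx, e⟩ := hp.exists_mem_Ico₀ Real.two_pi_pos ξ
  exact ⟨x, ⟨hx.1, hx.2.le⟩, fun s => congrFun e s⟩

theorem Sm.sliceCont (h : Sm T φ) {t : ℝ} (h0 : 0 ≤ t) (h1 : t < T) :
    Continuous (fun x => φ x t) :=
  continuous_iff_continuousAt.2 fun x => (h.diff1 h0 h1).continuousAt

theorem Sm.exists_max (h : Sm T φ) {t : ℝ} (h0 : 0 ≤ t) (h1 : t < T) :
    ∃ x, ∀ ξ, φ ξ t ≤ φ x t := by
  obtain ⟨x, hx, hm⟩ := (isCompact_Icc (a := (0 : ℝ)) (b := 2 * π)).exists_isMaxOn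
    (nonempty_Icc.2 Real.two_pi_pos.le) (h.sliceCont h0 h1).continuousOn
  refine ⟨x, fun ξ => ?_⟩
  obtain ⟨y, hy, e⟩ := h.per t ξ
  rw [e]; exact hm hy

theorem snd_deriv_nonpos {f : ℝ → ℝ} {x : ℝ} (hc : ContinuousAt f x) (hm : ∀ y, f y ≤ f x) :
    deriv f x = 0 ∧ deriv (deriv f) x ≤ 0 := by
  have hM : IsLocalMax f x := Filter.Eventually.of_forall hm
  have h0 := hM.deriv_eq_zero
  refine ⟨h0, ?_⟩
  by_contra! hpos
  have hmin := isLocalMin_of_deriv_deriv_pos hpos h0 hc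
  have hconst : f =ᶠ[𝓝 x] fun _ => f x := by
    filter_upwards [hmin] with y hy
    exact le_antisymm (hm y) hy
  have h2 : deriv f =ᶠ[𝓝 x] fun _ => 0 := by
    have := hconst.deriv
    simpa using this
  have := h2.deriv_eq
  simp at this
  linarith

theorem left_deriv_nonneg {f : ℝ → ℝ} {a x d : ℝ} (hax : a < x) (hd : HasDerivAt f d x)
    (hm : ∀ y, a ≤ y → y < x → f y ≤ f x) : 0 ≤ d := by
  have h := (hasDerivWithinAt_iff_tendsto_slope' (s := Set.Iio x) (by simp)).1 hd.hasDerivWithinAt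
  refine ge_of_tendsto h ?_
  filter_upwards [Ioo_mem_nhdsLT hax] with y hy
  rw [slope_def_field]
  exact div_nonneg_of_nonpos (by linarith [hm y hy.1.le hy.2]) (by linarith [hy.2])

namespace Flow

theorem at_max (F : Flow T ρ u v) {X : ℝ → ℝ → ℝ} (hX : Sm T X) {ξ t : ℝ} (h0 : 0 < t)
    (h1 : t < T) (hm : ∀ y, X y t ≤ X ξ t) :
    Ds ρ X ξ t = 0 ∧ Ds ρ (Ds ρ X) ξ t ≤ 0 := by
  obtain ⟨a1, a2⟩ := snd_deriv_nonpos (hX.diff1 (ξ := ξ) h0.le h1).continuousAt hm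
  have hr := F.ρ_pos ξ t h0.le h1
  have b1 : pd1 X ξ t = 0 := a1
  have b2 : pd1 (pd1 X) ξ t ≤ 0 := a2
  refine ⟨by simp [Ds, b1], ?_⟩
  have e : pd1 (Ds ρ X) ξ t = _ :=
    ((hX.pd1.hasPd1 h0.le h1).div (F.sρ.hasPd1 h0.le h1) hr.ne').deriv
  rw [Ds, e, b1]
  apply div_nonpos_of_nonpos_of_nonneg _ hr.le
  apply div_nonpos_of_nonpos_of_nonneg _ (by positivity)
  simp only [zero_mul, sub_zero]
  exact mul_nonpos_of_nonpos_of_nonneg b2 hr.le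

/-- Maximum principle. -/
theorem mp (F : Flow T ρ u v) {X : ℝ → ℝ → ℝ} (hX : Sm T X) {t0 : ℝ} (ht0 : 0 ≤ t0) (C k : ℝ)
    (hk : 0 ≤ k) (hi : ∀ ξ, X ξ t0 ≤ C)
    (H : ∀ ξ t, t0 < t → t < T → C < X ξ t → Ds ρ X ξ t = 0 → L ρ u v X ξ t ≤ k) :
    ∀ ξ t, t0 ≤ t → t < T → X ξ t ≤ C + k * (t - t0) := by
  intro ξ1 t1 ht1 ht1T
  by_contra! hcon
  rcases ht1.eq_or_lt with rfl | hlt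
  · have := hi ξ1; linarith
  obtain ⟨ε, hε, hε2⟩ : ∃ ε > 0, C + (k + ε) * (t1 - t0) < X ξ1 t1 := by
    refine ⟨(X ξ1 t1 - (C + k * (t1 - t0))) / (2 * (t1 - t0)), ?_, ?_⟩
    · apply div_pos <;> linarith
    · have : (X ξ1 t1 - (C + k * (t1 - t0))) / (2 * (t1 - t0)) * (t1 - t0)
          = (X ξ1 t1 - (C + k * (t1 - t0))) / 2 := by
        have : t1 - t0 ≠ 0 := by linarith
        field_simp
      rw [add_mul, this]; linarith
  set Y : ℝ × ℝ → ℝ := fun p => X p.1 p.2 - (k + ε) * (p.2 - t0) with hY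
  have hYc : ContinuousOn Y (Set.Icc 0 (2 * π) ×ˢ Set.Icc t0 t1) := by
    apply ContinuousOn.sub
    · exact hX.contOn.mono fun p hp => ⟨trivial, ht0.trans hp.2.1, hp.2.2.trans_lt ht1T⟩
    · fun_prop
  obtain ⟨⟨ξ, t⟩, ⟨hξ, ht⟩, hmax⟩ := (isCompact_Icc.prod isCompact_Icc).exists_isMaxOn
    ⟨((0 : ℝ), t0), ⟨le_rfl, Real.two_pi_pos.le⟩, le_rfl, ht1⟩ hYc
  simp only at ht
  have hmax' : ∀ y s, t0 ≤ s → s ≤ t1 → Y (y, s) ≤ Y (ξ, t) := by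
    intro y s hs hs'
    obtain ⟨x, hx, e⟩ := hX.per s y
    have := hmax (show (x, s) ∈ Set.Icc 0 (2 * π) ×ˢ Set.Icc t0 t1 from ⟨hx, hs, hs'⟩)
    simp only [hY, e] at this ⊢
    exact this
  have h1 := hmax' ξ1 t1 ht1 le_rfl
  have hC : C < Y (ξ, t) := lt_of_lt_of_le (by simp only [hY]; linarith) h1
  have htt : t0 < t := by
    rcases ht.1.eq_or_lt with rfl | h
    · simp only [hY, sub_self, mul_zero, sub_zero] at hC
      linarith [hi ξ]
    · exact h
  have hT : t < T := ht.2.trans_lt ht1T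
  have hpos : 0 < t := ht0.trans_lt htt
  obtain ⟨d1, d2⟩ := F.at_max hX hpos hT (ξ := ξ) fun y => by
    have := hmax' y t ht.1 ht.2
    simp only [hY] at this; linarith
  have hXC : C < X ξ t := by
    simp only [hY] at hC
    have : 0 ≤ (k + ε) * (t - t0) := by
      apply mul_nonneg <;> linarith
    linarith
  have hL := H ξ t htt hT hXC d1
  have hd : HasDerivAt (fun s => Y (ξ, s)) (pdt X ξ t - (k + ε) * 1) t :=
    (hX.hasPdt hpos hT).sub (((hasDerivAt_id t).sub_const t0).const_mul (k + ε))
  have := left_deriv_nonneg htt hd fun s hs hs' => hmax' ξ s hs (hs'.le.trans ht.2)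
  rw [L, d1] at hL
  linarith

/-- Bound version. -/
theorem bdd (F : Flow T ρ u v) {X : ℝ → ℝ → ℝ} (hX : Sm T X) (C : ℝ)
    (H : ∀ ξ t, 0 < t → t < T → C < X ξ t → Ds ρ X ξ t = 0 → L ρ u v X ξ t ≤ 0) :
    ∃ K, C ≤ K ∧ 0 < K ∧ ∀ ξ t, 0 ≤ t → t < T → X ξ t ≤ K := by
  obtain ⟨x, hx⟩ := hX.exists_max le_rfl F.T_pos
  refine ⟨max (max C (X x 0)) 1, (le_max_left _ _).trans (le_max_left _ _), by positivity, ?_⟩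
  intro ξ t h0 h1
  have := F.mp hX le_rfl (max (max C (X x 0)) 1) 0 le_rfl
    (fun ξ => (hx ξ).trans ((le_max_right _ _).trans (le_max_left _ _)))
    (fun ξ t a b c d => H ξ t a b (lt_of_le_of_lt ((le_max_left _ _).trans (le_max_left _ _)) c) d)
    ξ t h0 h1
  simpa using this

end Flow

theorem bern_alg {C k j V B p1 p2 q1 q2 l1 l2 m1 m2 x1 x2 : ℝ} (hC : 0 ≤ C)
    (hV : |V| ≤ 4) (hB : |B| ≤ C) (hq1 : |q1| ≤ C) (hq2 : |q2| ≤ C) (hm1 : |m1| ≤ C)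
    (hm2 : |m2| ≤ C) (hl1 : |l1| ≤ C * (1 + (|p1| + |p2|))) (hl2 : |l2| ≤ C * (1 + (|p1| + |p2|))) :
    (2 * p1 * l1 - 2 * x1 ^ 2 + p1 ^ 2 * (k * V - k ^ 2 * B ^ 2) - 4 * k * B * p1 * x1) +
    (2 * p2 * l2 - 2 * x2 ^ 2 + p2 ^ 2 * (k * V - k ^ 2 * B ^ 2) - 4 * k * B * p2 * x2) ≤
      2 * C + (8 * C + 4 * |k| + k ^ 2 * C ^ 2) * (p1 ^ 2 + p2 ^ 2) ∧
    (2 * q1 * m1 - 2 * p1 ^ 2 + q1 ^ 2 * (j * V - j ^ 2 * B ^ 2) - 4 * j * B * q1 * p1) +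
    (2 * q2 * m2 - 2 * p2 ^ 2 + q2 ^ 2 * (j * V - j ^ 2 * B ^ 2) - 4 * j * B * q2 * p2) ≤
      -(p1 ^ 2 + p2 ^ 2) + 2 * (2 * C ^ 2 + 4 * |j| * C ^ 2 + 3 * j ^ 2 * C ^ 4) := by
  have hB2 : B ^ 2 ≤ C ^ 2 := sq_le_sq' (abs_le.1 hB).1 (abs_le.1 hB).2
  have hV' : ∀ x : ℝ, x * V ≤ 4 * |x| := fun x => by
    have := le_abs_self (x * V)
    rw [abs_mul] at this
    nlinarith [abs_nonneg x]
  have hkB : k ^ 2 * B ^ 2 ≤ k ^ 2 * C ^ 2 := by gcongr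
  constructor
  · have hc : ∀ p x : ℝ, -2 * x ^ 2 + p ^ 2 * (k * V - k ^ 2 * B ^ 2) - 4 * k * B * p * x ≤
        (4 * |k| + k ^ 2 * C ^ 2) * p ^ 2 := fun p x => by
      have h1 : p ^ 2 * (k * V) ≤ p ^ 2 * (4 * |k|) := mul_le_mul_of_nonneg_left (hV' k) (sq_nonneg p)
      have h2 : p ^ 2 * (k ^ 2 * B ^ 2) ≤ p ^ 2 * (k ^ 2 * C ^ 2) := by gcongr
      nlinarith [sq_nonneg (x + k * B * p)]
    have hl : ∀ p l : ℝ, |l| ≤ C * (1 + (|p1| + |p2|)) →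
        2 * p * l ≤ 2 * |p| * (C * (1 + (|p1| + |p2|))) := fun p l h => by
      have h1 := le_abs_self (p * l)
      rw [abs_mul] at h1
      have h2 : |p| * |l| ≤ |p| * (C * (1 + (|p1| + |p2|))) := by gcongr
      linarith
    have hs : 2 * |p1| * (C * (1 + (|p1| + |p2|))) + 2 * |p2| * (C * (1 + (|p1| + |p2|)))
        ≤ 2 * C + 8 * C * (p1 ^ 2 + p2 ^ 2) := by
      rw [← sq_abs p1, ← sq_abs p2]
      have : (|p1| + |p2|) * (1 + (|p1| + |p2|)) ≤ 1 + 4 * (|p1| ^ 2 + |p2| ^ 2) := by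
        nlinarith [sq_nonneg (|p1| - |p2|), sq_nonneg (|p1| + |p2| - 1)]
      nlinarith
    have := hc p1 x1
    have := hc p2 x2
    have := hl p1 l1 hl1
    have := hl p2 l2 hl2
    linarith
  · have hc : ∀ q m p : ℝ, |q| ≤ C → |m| ≤ C →
        2 * q * m - 2 * p ^ 2 + q ^ 2 * (j * V - j ^ 2 * B ^ 2) - 4 * j * B * q * p ≤
        -p ^ 2 + (2 * C ^ 2 + 4 * |j| * C ^ 2 + 3 * j ^ 2 * C ^ 4) := fun q m p hq hm => by
      have hq2 : q ^ 2 ≤ C ^ 2 := sq_le_sq' (abs_le.1 hq).1 (abs_le.1 hq).2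
      have h0 : q * m ≤ C ^ 2 := by
        have h1 := le_abs_self (q * m)
        rw [abs_mul] at h1
        have : |q| * |m| ≤ C * C := by gcongr
        linarith
      have h1 : q ^ 2 * (j * V) ≤ C ^ 2 * (4 * |j|) := by
        calc q ^ 2 * (j * V) ≤ q ^ 2 * (4 * |j|) := mul_le_mul_of_nonneg_left (hV' j) (sq_nonneg q)
          _ ≤ _ := by gcongr
      have h2 : j ^ 2 * (B ^ 2 * q ^ 2) ≤ j ^ 2 * (C ^ 2 * C ^ 2) := by gcongr
      nlinarith [sq_nonneg (p + 2 * j * B * q)]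
    have := hc q1 m1 p1 hq1 hm1
    have := hc q2 m2 p2 hq2 hm2
    linarith

namespace Flow

section
variable {ξ t : ℝ}

theorem L_wsq (F : Flow T ρ u v) (h0 : 0 < t) (h1 : t < T) (h : Sm T φ) (k : ℝ) :
    L ρ u v (Ex (k • v) * (φ * φ)) ξ t = Real.exp (k * v ξ t) *
      (2 * φ ξ t * L ρ u v φ ξ t - 2 * Ds ρ φ ξ t ^ 2 + φ ξ t ^ 2 *
        (k * L ρ u v v ξ t - k ^ 2 * Ds ρ v ξ t ^ 2) - 4 * k * Ds ρ v ξ t * φ ξ t * Ds ρ φ ξ t) := by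
  have sv := F.sv
  rw [F.L_mul h0 h1 (sv.smul k).ex (h.mul h), F.L_mul h0 h1 h h, F.L_ex h0 h1 (sv.smul k),
    F.D_ex h0 h1 (sv.smul k), F.D_smul h0 h1 sv, F.L_smul h0 h1 sv, F.D_mul h0 h1 h h]
  simp only [Ex_apply, Pi.smul_apply, Pi.mul_apply, smul_eq_mul]
  ring

theorem La (F : Flow T ρ u v) (h0 : 0 < t) (h1 : t < T) :
    L ρ u v (Ds ρ u) ξ t =
      ((-4 : ℝ) • (Ex ((2 : ℝ) • u + (-4 : ℝ) • v) * (Ds ρ u - (2 : ℝ) • Ds ρ v))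
        - (Ds ρ u * Ds ρ u + (2 : ℝ) • (Ds ρ v * Ds ρ v)) * Ds ρ u) ξ t := by
  have su := F.su
  have sv := F.sv
  rw [F.L_D h0 h1 F.su, D_congr (ψ := (-2 : ℝ) • Ex ((2 : ℝ) • u + (-4 : ℝ) • v))
    (fun x => by rw [F.Lu x t h0 h1]; simp [Ex])]
  simp (maxDischargeDepth := 20) only [F.D_smul h0 h1, F.D_ex h0 h1, F.D_add h0 h1, Sm.ex, Sm.add, Sm.smul, su, sv]
  simp [Ex]
  ring

theorem Lb (F : Flow T ρ u v) (h0 : 0 < t) (h1 : t < T) :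
    L ρ u v (Ds ρ v) ξ t =
      ((4 : ℝ) • (Ex ((2 : ℝ) • u + (-4 : ℝ) • v) * (Ds ρ u - (2 : ℝ) • Ds ρ v))
        + (8 : ℝ) • (Ex ((-2 : ℝ) • v) * Ds ρ v)
        - (Ds ρ u * Ds ρ u + (2 : ℝ) • (Ds ρ v * Ds ρ v)) * Ds ρ v) ξ t := by
  have su := F.su
  have sv := F.sv
  rw [F.L_D h0 h1 F.sv, D_congr (ψ := (2 : ℝ) • Ex ((2 : ℝ) • u + (-4 : ℝ) • v)
      - (4 : ℝ) • Ex ((-2 : ℝ) • v))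
    (fun x => by rw [F.Lv x t h0 h1]; simp [Ex])]
  simp (maxDischargeDepth := 20) only [F.D_smul h0 h1, F.D_ex h0 h1, F.D_add h0 h1, F.D_sub h0 h1, Sm.ex, Sm.add,
    Sm.smul, su, sv]
  simp [Ex]
  ring

theorem Lα (F : Flow T ρ u v) (h0 : 0 < t) (h1 : t < T) :
    L ρ u v (Ds ρ (Ds ρ u)) ξ t =
      -4 * (Real.exp (2 * u ξ t + -4 * v ξ t) * (2 * (Ds ρ u ξ t - 2 * Ds ρ v ξ t) ^ 2
        + (Ds ρ (Ds ρ u) ξ t - 2 * Ds ρ (Ds ρ v) ξ t)))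
      - 2 * (Ds ρ u ξ t ^ 2 + 2 * Ds ρ v ξ t ^ 2) * Ds ρ (Ds ρ u) ξ t
      - (2 * Ds ρ u ξ t * Ds ρ (Ds ρ u) ξ t + 4 * Ds ρ v ξ t * Ds ρ (Ds ρ v) ξ t)
        * Ds ρ u ξ t := by
  have su := F.su
  have sv := F.sv
  have sa := F.sD su
  have sb := F.sD sv
  rw [F.L_D h0 h1 sa, D_congr (fun x => F.La h0 h1)]
  simp (maxDischargeDepth := 20) only [F.D_smul h0 h1, F.D_ex h0 h1, F.D_add h0 h1, F.D_sub h0 h1, F.D_mul h0 h1, Sm.ex,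
    Sm.add, Sm.sub, Sm.mul, Sm.smul, su, sv, sa, sb]
  simp [Ex]
  ring

theorem Lβ (F : Flow T ρ u v) (h0 : 0 < t) (h1 : t < T) :
    L ρ u v (Ds ρ (Ds ρ v)) ξ t =
      4 * (Real.exp (2 * u ξ t + -4 * v ξ t) * (2 * (Ds ρ u ξ t - 2 * Ds ρ v ξ t) ^ 2
        + (Ds ρ (Ds ρ u) ξ t - 2 * Ds ρ (Ds ρ v) ξ t)))
      + 8 * (Real.exp (-2 * v ξ t) * (Ds ρ (Ds ρ v) ξ t - 2 * Ds ρ v ξ t ^ 2))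
      - 2 * (Ds ρ u ξ t ^ 2 + 2 * Ds ρ v ξ t ^ 2) * Ds ρ (Ds ρ v) ξ t
      - (2 * Ds ρ u ξ t * Ds ρ (Ds ρ u) ξ t + 4 * Ds ρ v ξ t * Ds ρ (Ds ρ v) ξ t)
        * Ds ρ v ξ t := by
  have su := F.su
  have sv := F.sv
  have sa := F.sD su
  have sb := F.sD sv
  rw [F.L_D h0 h1 sb, D_congr (fun x => F.Lb h0 h1)]
  simp (maxDischargeDepth := 20) only [F.D_smul h0 h1, F.D_ex h0 h1, F.D_add h0 h1, F.D_sub h0 h1, F.D_mul h0 h1, Sm.ex,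
    Sm.add, Sm.sub, Sm.mul, Sm.smul, su, sv, sa, sb]
  simp [Ex]
  ring

end

theorem bern (F : Flow T ρ u v) (m C : ℝ) (hC : 0 ≤ C) {φ1 φ2 : ℝ → ℝ → ℝ} (s1 : Sm T φ1)
    (s2 : Sm T φ2)
    (huv : ∀ ξ t, 0 ≤ t → t < T → u ξ t ≤ v ξ t)
    (hb : ∀ ξ t, 0 ≤ t → t < T → |Real.exp (v ξ t) * Ds ρ v ξ t| ≤ C)
    (hφ1 : ∀ ξ t, 0 ≤ t → t < T → |Real.exp (-m * v ξ t) * φ1 ξ t| ≤ C)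
    (hφ2 : ∀ ξ t, 0 ≤ t → t < T → |Real.exp (-m * v ξ t) * φ2 ξ t| ≤ C)
    (hL1 : ∀ ξ t, 0 < t → t < T →
      |Real.exp (-m * v ξ t) * Real.exp (v ξ t) ^ 2 * L ρ u v φ1 ξ t| ≤ C)
    (hL2 : ∀ ξ t, 0 < t → t < T →
      |Real.exp (-m * v ξ t) * Real.exp (v ξ t) ^ 2 * L ρ u v φ2 ξ t| ≤ C)
    (hD1 : ∀ ξ t, 0 < t → t < T →
      |Real.exp (-m * v ξ t) * Real.exp (v ξ t) ^ 3 * L ρ u v (Ds ρ φ1) ξ t| ≤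
        C * (1 + (|Real.exp (-m * v ξ t) * Real.exp (v ξ t) * Ds ρ φ1 ξ t|
          + |Real.exp (-m * v ξ t) * Real.exp (v ξ t) * Ds ρ φ2 ξ t|)))
    (hD2 : ∀ ξ t, 0 < t → t < T →
      |Real.exp (-m * v ξ t) * Real.exp (v ξ t) ^ 3 * L ρ u v (Ds ρ φ2) ξ t| ≤
        C * (1 + (|Real.exp (-m * v ξ t) * Real.exp (v ξ t) * Ds ρ φ1 ξ t|
          + |Real.exp (-m * v ξ t) * Real.exp (v ξ t) * Ds ρ φ2 ξ t|))) :
    ∃ C' > 0, ∀ ξ t, 0 ≤ t → t < T →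
      |Real.exp (-m * v ξ t) * Real.exp (v ξ t) * Ds ρ φ1 ξ t| ≤ C' ∧
      |Real.exp (-m * v ξ t) * Real.exp (v ξ t) * Ds ρ φ2 ξ t| ≤ C' := by
  set k : ℝ := 2 - 2 * m with hk
  set j : ℝ := -2 * m with hj
  set C1 := 8 * C + 4 * |k| + k ^ 2 * C ^ 2 with hC1
  set C2 := 2 * C ^ 2 + 4 * |j| * C ^ 2 + 3 * j ^ 2 * C ^ 4 with hC2
  have hC1p : 0 ≤ C1 := by positivity
  have hC2p : 0 ≤ C2 := by positivity
  have d1 := F.sD s1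
  have d2 := F.sD s2
  have sk := (F.sv.smul k).ex
  have sj := (F.sv.smul j).ex
  have hek : ∀ ξ t, Real.exp (k * v ξ t) = Real.exp (-m * v ξ t) ^ 2 * Real.exp (v ξ t) ^ 2 := by
    intro ξ t
    rw [← Real.exp_nat_mul, ← Real.exp_nat_mul, ← Real.exp_add]; congr 1; push_cast; rw [hk]; ring
  have hej : ∀ ξ t, Real.exp (j * v ξ t) = Real.exp (-m * v ξ t) ^ 2 := by
    intro ξ t
    rw [← Real.exp_nat_mul]; congr 1; push_cast; rw [hj]; ring
  set X := (Ex (k • v) * (Ds ρ φ1 * Ds ρ φ1) + Ex (k • v) * (Ds ρ φ2 * Ds ρ φ2)) +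
    (C1 + 1) • (Ex (j • v) * (φ1 * φ1) + Ex (j • v) * (φ2 * φ2)) with hX
  have a1 := sk.mul (d1.mul d1)
  have a2 := sk.mul (d2.mul d2)
  have b1 := sj.mul (s1.mul s1)
  have b2 := sj.mul (s2.mul s2)
  have sX : Sm T X := (a1.add a2).add ((b1.add b2).smul _)
  have hXe : ∀ ξ t, X ξ t =
      (Real.exp (-m * v ξ t) * Real.exp (v ξ t) * Ds ρ φ1 ξ t) ^ 2 +
      (Real.exp (-m * v ξ t) * Real.exp (v ξ t) * Ds ρ φ2 ξ t) ^ 2 +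
      (C1 + 1) * ((Real.exp (-m * v ξ t) * φ1 ξ t) ^ 2 + (Real.exp (-m * v ξ t) * φ2 ξ t) ^ 2) := by
    intro ξ t
    simp only [hX, Pi.add_apply, Pi.mul_apply, Pi.smul_apply, Ex_apply, smul_eq_mul, hek, hej]
    ring
  obtain ⟨K, _, hK0, hK⟩ := F.bdd sX (2 * C + 2 * (C1 + 1) * C2 + 2 * (C1 + 1) * C ^ 2) (by
    intro ξ t h0 h1 hXC _
    rw [hXe] at hXC
    have he := Real.exp_pos (v ξ t)
    have hV : |Real.exp (v ξ t) ^ 2 * L ρ u v v ξ t| ≤ 4 := by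
      rw [F.Lv ξ t h0 h1]
      have e1 : Real.exp (v ξ t) ^ 2 * Real.exp (2 * u ξ t + -4 * v ξ t)
          = Real.exp (2 * (u ξ t - v ξ t)) := by
        rw [← Real.exp_nat_mul, ← Real.exp_add]; congr 1; push_cast; ring
      have e2 : Real.exp (v ξ t) ^ 2 * Real.exp (-2 * v ξ t) = 1 := by
        rw [← Real.exp_nat_mul, ← Real.exp_add, ← Real.exp_zero]; congr 1; push_cast; ring
      have e3 : Real.exp (2 * (u ξ t - v ξ t)) ≤ 1 :=
        Real.exp_le_one_iff.2 (by linarith [huv ξ t h0.le h1])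
      have e4 := Real.exp_pos (2 * (u ξ t - v ξ t))
      have : Real.exp (v ξ t) ^ 2 * (2 * Real.exp (2 * u ξ t + -4 * v ξ t)
          - 4 * Real.exp (-2 * v ξ t)) = 2 * Real.exp (2 * (u ξ t - v ξ t)) - 4 := by
        linear_combination 2 * e1 - 4 * e2
      rw [this, abs_le]; constructor <;> linarith
    obtain ⟨i1, i2⟩ := bern_alg (k := k) (j := j) hC hV (hb ξ t h0.le h1) (hφ1 ξ t h0.le h1)
      (hφ2 ξ t h0.le h1) (hL1 ξ t h0 h1) (hL2 ξ t h0 h1) (hD1 ξ t h0 h1) (hD2 ξ t h0 h1)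
      (x1 := Real.exp (-m * v ξ t) * Real.exp (v ξ t) ^ 2 * Ds ρ (Ds ρ φ1) ξ t)
      (x2 := Real.exp (-m * v ξ t) * Real.exp (v ξ t) ^ 2 * Ds ρ (Ds ρ φ2) ξ t)
    have q1 : (Real.exp (-m * v ξ t) * φ1 ξ t) ^ 2 ≤ C ^ 2 :=
      sq_le_sq' (abs_le.1 (hφ1 ξ t h0.le h1)).1 (abs_le.1 (hφ1 ξ t h0.le h1)).2
    have q2 : (Real.exp (-m * v ξ t) * φ2 ξ t) ^ 2 ≤ C ^ 2 :=
      sq_le_sq' (abs_le.1 (hφ2 ξ t h0.le h1)).1 (abs_le.1 (hφ2 ξ t h0.le h1)).2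
    have i3 := mul_le_mul_of_nonneg_left i2 (show 0 ≤ C1 + 1 by linarith)
    have i4 : (C1 + 1) * ((Real.exp (-m * v ξ t) * φ1 ξ t) ^ 2
        + (Real.exp (-m * v ξ t) * φ2 ξ t) ^ 2) ≤ (C1 + 1) * (C ^ 2 + C ^ 2) := by gcongr
    have hneg : Real.exp (v ξ t) ^ 2 * L ρ u v X ξ t ≤ 0 := by
      rw [hX, F.L_add h0 h1 (a1.add a2) ((b1.add b2).smul _), F.L_smul h0 h1 (b1.add b2),
        F.L_add h0 h1 a1 a2, F.L_add h0 h1 b1 b2, F.L_wsq h0 h1 d1, F.L_wsq h0 h1 d2,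
        F.L_wsq h0 h1 s1, F.L_wsq h0 h1 s2, hek, hej]
      refine le_trans (le_of_eq ?_) (le_trans (add_le_add i1 i3) ?_)
      · ring
      · rw [← hC1, ← hC2]; linarith
    exact nonpos_of_mul_nonpos_right hneg (by positivity))
  have fin : ∀ p : ℝ, p ^ 2 ≤ K → |p| ≤ K + 1 := fun p hp => by
    rw [← sq_abs] at hp
    nlinarith [sq_nonneg (|p| - 1)]
  refine ⟨K + 1, by linarith, fun ξ t h0 h1 => ?_⟩
  have h := hK ξ t h0 h1
  rw [hXe] at h
  have n1 : 0 ≤ (C1 + 1) * ((Real.exp (-m * v ξ t) * φ1 ξ t) ^ 2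
        + (Real.exp (-m * v ξ t) * φ2 ξ t) ^ 2) := by positivity
  constructor
  · apply fin
    linarith [sq_nonneg (Real.exp (-m * v ξ t) * Real.exp (v ξ t) * Ds ρ φ2 ξ t)]
  · apply fin
    linarith [sq_nonneg (Real.exp (-m * v ξ t) * Real.exp (v ξ t) * Ds ρ φ1 ξ t)]

end Flow

theorem mulbd {x y p q : ℝ} (h : |x| ≤ p) (k : |y| ≤ q) : |x * y| ≤ p * q := by
  rw [abs_mul]; exact mul_le_mul h k (abs_nonneg _) ((abs_nonneg _).trans h)
theorem addbd {x y p q : ℝ} (h : |x| ≤ p) (k : |y| ≤ q) : |x + y| ≤ p + q :=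
  (abs_add_le x y).trans (add_le_add h k)
theorem subbd {x y p q : ℝ} (h : |x| ≤ p) (k : |y| ≤ q) : |x - y| ≤ p + q :=
  (abs_sub x y).trans (add_le_add h k)
theorem cbd {x p : ℝ} (c : ℝ) (h : |x| ≤ p) : |c * x| ≤ |c| * p := by
  rw [abs_mul]; gcongr

theorem eE (x y : ℝ) : Real.exp y ^ 2 * Real.exp (2 * x + -4 * y) = Real.exp (2 * (x - y)) := by
  rw [← Real.exp_nat_mul, ← Real.exp_add]; congr 1; push_cast; ring
theorem eG (y : ℝ) : Real.exp y ^ 2 * Real.exp (-2 * y) = 1 := by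
  rw [← Real.exp_nat_mul, ← Real.exp_add, ← Real.exp_zero]; congr 1; push_cast; ring

namespace Flow

theorem ord (F : Flow T ρ u v) (hi : ∀ ξ, u ξ 0 ≤ v ξ 0) :
    ∀ ξ t, 0 ≤ t → t < T → u ξ t ≤ v ξ t := by
  intro ξ t h0 h1
  have := F.mp (F.su.sub F.sv) le_rfl 0 0 le_rfl (fun ξ => by simpa using hi ξ) (by
    intro ξ t h0 h1 hX _
    rw [F.L_sub h0 h1 F.su F.sv, F.Lu ξ t h0 h1, F.Lv ξ t h0 h1]
    have : Real.exp (-2 * v ξ t) ≤ Real.exp (2 * u ξ t + -4 * v ξ t) := by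
      apply Real.exp_le_exp.2
      simp at hX; linarith
    linarith) ξ t h0 h1
  simpa using this

theorem zbd (F : Flow T ρ u v) (huv : ∀ ξ t, 0 ≤ t → t < T → u ξ t ≤ v ξ t) :
    ∃ Z > 0, ∀ ξ t, 0 ≤ t → t < T → v ξ t - u ξ t ≤ Z := by
  obtain ⟨Z, _, hZ, h⟩ := F.bdd (F.sv.sub F.su) 0 (by
    intro ξ t h0 h1 hX _
    rw [F.L_sub h0 h1 F.sv F.su, F.Lu ξ t h0 h1, F.Lv ξ t h0 h1]
    have : Real.exp (2 * u ξ t + -4 * v ξ t) ≤ Real.exp (-2 * v ξ t) := by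
      apply Real.exp_le_exp.2
      linarith [huv ξ t h0.le h1]
    linarith)
  exact ⟨Z, hZ, h⟩

theorem vbd (F : Flow T ρ u v) (huv : ∀ ξ t, 0 ≤ t → t < T → u ξ t ≤ v ξ t) (C : ℝ)
    (hC : ∀ ξ, v ξ 0 ≤ C) : ∀ ξ t, 0 ≤ t → t < T → v ξ t ≤ C := by
  intro ξ t h0 h1
  have := F.mp F.sv le_rfl C 0 le_rfl hC (by
    intro ξ t h0 h1 hX _
    rw [F.Lv ξ t h0 h1]
    have : Real.exp (2 * u ξ t + -4 * v ξ t) ≤ Real.exp (-2 * v ξ t) := by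
      apply Real.exp_le_exp.2
      linarith [huv ξ t h0.le h1]
    linarith [Real.exp_pos (-2 * v ξ t)]) ξ t h0 h1
  simpa using this

theorem ab_alg {A B r P : ℝ} (hr : 0 ≤ r) (hr1 : r ≤ 1) (hP : P = A ^ 2 + B ^ 2) (h : 10 < P) :
    -8 * r * (A - 2 * B) * A + 8 * r * (A - 2 * B) * B + 16 * B ^ 2 + (4 * r - 8) * P
      - 2 * P ^ 2 ≤ 0 := by
  have h1 : r * (A * B) ≤ r * (P / 2) := by
    apply mul_le_mul_of_nonneg_left _ hr
    rw [hP]; nlinarith [sq_nonneg (A - B)]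
  have h2 : r * P ≤ P := by nlinarith
  have h3 : B ^ 2 ≤ P := by rw [hP]; nlinarith [sq_nonneg A]
  have h4 : 0 ≤ r * A ^ 2 := by positivity
  have h5 : 0 ≤ r * B ^ 2 := by positivity
  nlinarith

theorem ab (F : Flow T ρ u v) (huv : ∀ ξ t, 0 ≤ t → t < T → u ξ t ≤ v ξ t) :
    ∃ C > 0, ∀ ξ t, 0 ≤ t → t < T →
      |Real.exp (v ξ t) * Ds ρ u ξ t| ≤ C ∧ |Real.exp (v ξ t) * Ds ρ v ξ t| ≤ C := by
  have sa := F.sD F.su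
  have sb := F.sD F.sv
  have sk := (F.sv.smul 2).ex
  have hX : ∀ ξ t, (Ex ((2 : ℝ) • v) * (Ds ρ u * Ds ρ u) + Ex ((2 : ℝ) • v) * (Ds ρ v * Ds ρ v)) ξ t
      = (Real.exp (v ξ t) * Ds ρ u ξ t) ^ 2 + (Real.exp (v ξ t) * Ds ρ v ξ t) ^ 2 := by
    intro ξ t
    have : Real.exp (2 * v ξ t) = Real.exp (v ξ t) ^ 2 := by rw [← Real.exp_nat_mul]; norm_num
    simp only [Pi.add_apply, Pi.mul_apply, Ex_apply, Pi.smul_apply, smul_eq_mul, this]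
    ring
  obtain ⟨K, _, hK0, hK⟩ := F.bdd ((sk.mul (sa.mul sa)).add (sk.mul (sb.mul sb))) 10 (by
    intro ξ t h0 h1 hXC hD
    rw [hX] at hXC
    have h2 : Real.exp (2 * v ξ t) = Real.exp (v ξ t) ^ 2 := by rw [← Real.exp_nat_mul]; norm_num
    have he := Real.exp_pos (v ξ t)
    rw [F.D_add h0 h1 (sk.mul (sa.mul sa)) (sk.mul (sb.mul sb)), F.D_mul h0 h1 sk (sa.mul sa),
      F.D_mul h0 h1 sk (sb.mul sb), F.D_mul h0 h1 sa sa, F.D_mul h0 h1 sb sb,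
      F.D_ex h0 h1 (F.sv.smul 2), F.D_smul h0 h1 F.sv] at hD
    rw [F.L_add h0 h1 (sk.mul (sa.mul sa)) (sk.mul (sb.mul sb)), F.L_wsq h0 h1 sa,
      F.L_wsq h0 h1 sb, F.La h0 h1, F.Lb h0 h1, F.Lv ξ t h0 h1]
    simp only [Pi.add_apply, Pi.sub_apply, Pi.mul_apply, Ex_apply, Pi.smul_apply, smul_eq_mul, h2]
      at hD ⊢
    have e1 := eE (u ξ t) (v ξ t)
    have e2 := eG (v ξ t)
    have e3 : Real.exp (2 * (u ξ t - v ξ t)) ≤ 1 :=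
      Real.exp_le_one_iff.2 (by linarith [huv ξ t h0.le h1])
    have e4 := Real.exp_pos (2 * (u ξ t - v ξ t))
    have key := ab_alg e4.le e3 rfl hXC
    generalize Real.exp (2 * (u ξ t - v ξ t)) = r at *
    generalize Real.exp (2 * u ξ t + -4 * v ξ t) = E at *
    generalize Real.exp (-2 * v ξ t) = G at *
    generalize Real.exp (v ξ t) = e at *
    generalize Ds ρ (Ds ρ u) ξ t = α at *
    generalize Ds ρ (Ds ρ v) ξ t = β at *
    generalize Ds ρ u ξ t = a at *
    generalize Ds ρ v ξ t = b at *
    have hD' : a * α + b * β + b * (a ^ 2 + b ^ 2) = 0 := by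
      have : e ^ 2 * (2 * (a * α + b * β + b * (a ^ 2 + b ^ 2))) = 0 := by linarith
      have h := (mul_eq_zero.1 this).resolve_left (by positivity)
      linarith
    refine nonpos_of_mul_nonpos_right (a := e ^ 2) ?_ (by positivity)
    refine le_trans (le_of_eq ?_) (le_trans (sub_le_self _
      (show 0 ≤ 2 * e ^ 4 * ((α + a * b) ^ 2 + (β + b ^ 2) ^ 2) by positivity)) key)
    subst e1
    linear_combination (-4 * e ^ 4 * b) * hD' + (16 * e ^ 2 * b ^ 2 - 8 * e ^ 2 * (a ^ 2 + b ^ 2)) * e2)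
  have fin : ∀ p : ℝ, p ^ 2 ≤ K → |p| ≤ K + 1 := fun p hp => by
    rw [← sq_abs] at hp
    nlinarith [sq_nonneg (|p| - 1)]
  refine ⟨K + 1, by linarith, fun ξ t h0 h1 => ?_⟩
  have h := hK ξ t h0 h1
  rw [hX] at h
  constructor
  · apply fin
    linarith [sq_nonneg (Real.exp (v ξ t) * Ds ρ v ξ t)]
  · apply fin
    linarith [sq_nonneg (Real.exp (v ξ t) * Ds ρ u ξ t)]

theorem αβ (F : Flow T ρ u v) (huv : ∀ ξ t, 0 ≤ t → t < T → u ξ t ≤ v ξ t) {C0 : ℝ} (hC0 : 0 < C0)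
    (hab : ∀ ξ t, 0 ≤ t → t < T →
      |Real.exp (v ξ t) * Ds ρ u ξ t| ≤ C0 ∧ |Real.exp (v ξ t) * Ds ρ v ξ t| ≤ C0) :
    ∃ C > 0, ∀ ξ t, 0 ≤ t → t < T →
      |Real.exp (v ξ t) ^ 2 * Ds ρ (Ds ρ u) ξ t| ≤ C ∧
      |Real.exp (v ξ t) ^ 2 * Ds ρ (Ds ρ v) ξ t| ≤ C := by
  have sa := F.sD F.su
  have sb := F.sD F.sv
  have hm : ∀ ξ t, Real.exp (- -1 * v ξ t) = Real.exp (v ξ t) := by intro ξ t; simp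
  obtain ⟨C', hC', h⟩ := F.bern (-1) (20 * C0 + 3 * C0 ^ 3 + 100 * C0 ^ 2 + 20) (by positivity)
    sa sb huv
    (fun ξ t h0 h1 => (hab ξ t h0 h1).2.trans (by nlinarith [pow_pos hC0 2, pow_pos hC0 3]))
    (fun ξ t h0 h1 => by
      rw [hm]; exact (hab ξ t h0 h1).1.trans (by nlinarith [pow_pos hC0 2, pow_pos hC0 3]))
    (fun ξ t h0 h1 => by
      rw [hm]; exact (hab ξ t h0 h1).2.trans (by nlinarith [pow_pos hC0 2, pow_pos hC0 3]))
    (fun ξ t h0 h1 => by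
      rw [hm, F.La h0 h1]
      obtain ⟨hA, hB⟩ := hab ξ t h0.le h1
      have e1 := eE (u ξ t) (v ξ t)
      have e3 : |Real.exp (2 * (u ξ t - v ξ t))| ≤ 1 := by
        rw [abs_of_pos (Real.exp_pos _)]
        exact Real.exp_le_one_iff.2 (by linarith [huv ξ t h0.le h1])
      simp only [Pi.add_apply, Pi.sub_apply, Pi.mul_apply, Ex_apply, Pi.smul_apply, smul_eq_mul]
      rw [← e1] at e3
      have := subbd (cbd (-4) (mulbd e3 (subbd hA (cbd 2 hB))))
        (mulbd (addbd (mulbd hA hA) (cbd 2 (mulbd hB hB))) hA)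
      norm_num only [abs_neg, abs_two, Nat.abs_ofNat] at this
      refine le_trans (le_of_eq ?_) (this.trans ?_)
      · congr 1; ring
      · nlinarith [pow_pos hC0 2, pow_pos hC0 3])
    (fun ξ t h0 h1 => by
      rw [hm, F.Lb h0 h1]
      obtain ⟨hA, hB⟩ := hab ξ t h0.le h1
      have e1 := eE (u ξ t) (v ξ t)
      have e2 := eG (v ξ t)
      have e3 : |Real.exp (2 * (u ξ t - v ξ t))| ≤ 1 := by
        rw [abs_of_pos (Real.exp_pos _)]
        exact Real.exp_le_one_iff.2 (by linarith [huv ξ t h0.le h1])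
      simp only [Pi.add_apply, Pi.sub_apply, Pi.mul_apply, Ex_apply, Pi.smul_apply, smul_eq_mul]
      rw [← e1] at e3
      have := subbd (addbd (cbd 4 (mulbd e3 (subbd hA (cbd 2 hB)))) (cbd 8 hB))
        (mulbd (addbd (mulbd hA hA) (cbd 2 (mulbd hB hB))) hB)
      norm_num only [abs_neg, abs_two, Nat.abs_ofNat] at this
      refine le_trans (le_of_eq ?_) (this.trans ?_)
      · congr 1
        linear_combination 8 * Real.exp (v ξ t) * Ds ρ v ξ t * e2
      · nlinarith [pow_pos hC0 2, pow_pos hC0 3])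
    (fun ξ t h0 h1 => by
      rw [hm, F.Lα h0 h1]
      obtain ⟨hA, hB⟩ := hab ξ t h0.le h1
      have e1 := eE (u ξ t) (v ξ t)
      have e3 : |Real.exp (2 * (u ξ t - v ξ t))| ≤ 1 := by
        rw [abs_of_pos (Real.exp_pos _)]
        exact Real.exp_le_one_iff.2 (by linarith [huv ξ t h0.le h1])
      rw [← e1] at e3
      have hx := le_refl |Real.exp (v ξ t) * Real.exp (v ξ t) * Ds ρ (Ds ρ u) ξ t|
      have hy := le_refl |Real.exp (v ξ t) * Real.exp (v ξ t) * Ds ρ (Ds ρ v) ξ t|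
      have hd := subbd hA (cbd 2 hB)
      have := subbd (subbd (cbd (-4) (mulbd e3 (addbd (cbd 2 (mulbd hd hd))
        (subbd hx (cbd 2 hy)))))
        (cbd 2 (mulbd (addbd (mulbd hA hA) (cbd 2 (mulbd hB hB))) hx)))
        (mulbd (addbd (cbd 2 (mulbd hA hx)) (cbd 4 (mulbd hB hy))) hA)
      norm_num only [abs_neg, abs_two, Nat.abs_ofNat] at this
      refine le_trans (le_of_eq ?_) (this.trans ?_)
      · congr 1; ring
      · have p1 := abs_nonneg (Real.exp (v ξ t) * Real.exp (v ξ t) * Ds ρ (Ds ρ u) ξ t)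
        have p2 := abs_nonneg (Real.exp (v ξ t) * Real.exp (v ξ t) * Ds ρ (Ds ρ v) ξ t)
        generalize |Real.exp (v ξ t) * Real.exp (v ξ t) * Ds ρ (Ds ρ u) ξ t| = x at *
        generalize |Real.exp (v ξ t) * Real.exp (v ξ t) * Ds ρ (Ds ρ v) ξ t| = y at *
        have := pow_pos hC0 2
        have := pow_pos hC0 3
        rw [← sub_nonneg]; ring_nf; nlinarith [mul_nonneg (pow_pos hC0 2).le p1, mul_nonneg (pow_pos hC0 2).le p2, mul_nonneg (pow_pos hC0 3).le p1, mul_nonneg (pow_pos hC0 3).le p2, mul_nonneg hC0.le p1, mul_nonneg hC0.le p2])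
    (fun ξ t h0 h1 => by
      rw [hm, F.Lβ h0 h1]
      obtain ⟨hA, hB⟩ := hab ξ t h0.le h1
      have e1 := eE (u ξ t) (v ξ t)
      have e2 := eG (v ξ t)
      have e3 : |Real.exp (2 * (u ξ t - v ξ t))| ≤ 1 := by
        rw [abs_of_pos (Real.exp_pos _)]
        exact Real.exp_le_one_iff.2 (by linarith [huv ξ t h0.le h1])
      rw [← e1] at e3
      have hx := le_refl |Real.exp (v ξ t) * Real.exp (v ξ t) * Ds ρ (Ds ρ u) ξ t|
      have hy := le_refl |Real.exp (v ξ t) * Real.exp (v ξ t) * Ds ρ (Ds ρ v) ξ t|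
      have hd := subbd hA (cbd 2 hB)
      have := subbd (subbd (addbd (cbd 4 (mulbd e3 (addbd (cbd 2 (mulbd hd hd))
        (subbd hx (cbd 2 hy))))) (cbd 8 (subbd hy (cbd 2 (mulbd hB hB)))))
        (cbd 2 (mulbd (addbd (mulbd hA hA) (cbd 2 (mulbd hB hB))) hy)))
        (mulbd (addbd (cbd 2 (mulbd hA hx)) (cbd 4 (mulbd hB hy))) hB)
      norm_num only [abs_neg, abs_two, Nat.abs_ofNat] at this
      refine le_trans (le_of_eq ?_) (this.trans ?_)
      · congr 1
        linear_combination 8 * Real.exp (v ξ t) ^ 2 * (Ds ρ (Ds ρ v) ξ t - 2 * Ds ρ v ξ t ^ 2) * e2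
      · have p1 := abs_nonneg (Real.exp (v ξ t) * Real.exp (v ξ t) * Ds ρ (Ds ρ u) ξ t)
        have p2 := abs_nonneg (Real.exp (v ξ t) * Real.exp (v ξ t) * Ds ρ (Ds ρ v) ξ t)
        generalize |Real.exp (v ξ t) * Real.exp (v ξ t) * Ds ρ (Ds ρ u) ξ t| = x at *
        generalize |Real.exp (v ξ t) * Real.exp (v ξ t) * Ds ρ (Ds ρ v) ξ t| = y at *
        have := pow_pos hC0 2
        have := pow_pos hC0 3
        rw [← sub_nonneg]; ring_nf; nlinarith [mul_nonneg (pow_pos hC0 2).le p1, mul_nonneg (pow_pos hC0 2).le p2, mul_nonneg (pow_pos hC0 3).le p1, mul_nonneg (pow_pos hC0 3).le p2, mul_nonneg hC0.le p1, mul_nonneg hC0.le p2])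
  refine ⟨C', hC', fun ξ t h0 h1 => ?_⟩
  have := h ξ t h0 h1
  simpa only [hm, ← sq] using this

end Flow

namespace Flow

theorem δbd (F : Flow T ρ u v) (huv : ∀ ξ t, 0 ≤ t → t < T → u ξ t ≤ v ξ t) {Z C0 : ℝ}
    (hZ0 : 0 < Z) (hC0 : 0 < C0)
    (hZ : ∀ ξ t, 0 ≤ t → t < T → v ξ t - u ξ t ≤ Z)
    (hab : ∀ ξ t, 0 ≤ t → t < T →
      |Real.exp (v ξ t) * Ds ρ u ξ t| ≤ C0 ∧ |Real.exp (v ξ t) * Ds ρ v ξ t| ≤ C0) :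
    ∃ δ > 0, ∃ C > 0, ∀ ξ t, 0 ≤ t → t < T →
      Real.exp (-δ * v ξ t) * (v ξ t - u ξ t) ≤ C := by
  have hden : 0 < (1 + 2 * Z) * (1 + C0 ^ 2) := by positivity
  set δ := 1 / ((1 + 2 * Z) * (1 + C0 ^ 2)) with hδ
  have hδ0 : 0 < δ := by positivity
  have hδ1 : δ ≤ 1 := by
    rw [hδ, div_le_one hden]; nlinarith [sq_nonneg C0]
  have hδ2 : δ * (1 + C0 ^ 2) * (1 + 2 * Z) = 1 := by rw [hδ]; field_simp
  have sz := F.sv.sub F.su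
  have sh := (F.sv.smul (-δ)).ex
  obtain ⟨K, _, hK0, hK⟩ := F.bdd (sh.mul sz) 0 (by
    intro ξ t h0 h1 hX hD
    rw [F.D_mul h0 h1 sh sz, F.D_ex h0 h1 (F.sv.smul (-δ)), F.D_smul h0 h1 F.sv] at hD
    rw [F.L_mul h0 h1 sh sz, F.L_ex h0 h1 (F.sv.smul (-δ)), F.L_smul h0 h1 F.sv,
      F.D_ex h0 h1 (F.sv.smul (-δ)), F.D_smul h0 h1 F.sv,
      F.L_sub h0 h1 F.sv F.su, F.Lu ξ t h0 h1, F.Lv ξ t h0 h1]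
    simp only [Pi.sub_apply, Pi.mul_apply, Ex_apply, Pi.smul_apply, smul_eq_mul] at hX hD ⊢
    have hh := Real.exp_pos (-δ * v ξ t)
    have he := Real.exp_pos (v ξ t)
    have hz : 0 < v ξ t - u ξ t := pos_of_mul_pos_right hX hh.le
    have hzZ := hZ ξ t h0.le h1
    have hB := (hab ξ t h0.le h1).2
    have hB2 : (Real.exp (v ξ t) * Ds ρ v ξ t) ^ 2 ≤ C0 ^ 2 :=
      sq_le_sq' (abs_le.1 hB).1 (abs_le.1 hB).2
    have e1 := eE (u ξ t) (v ξ t)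
    have e2 := eG (v ξ t)
    have e3 := Real.exp_pos (2 * (u ξ t - v ξ t))
    have e4 : Real.exp (2 * (u ξ t - v ξ t)) * (1 + 2 * (v ξ t - u ξ t)) ≤ 1 := by
      have := Real.add_one_le_exp (2 * (v ξ t - u ξ t))
      calc Real.exp (2 * (u ξ t - v ξ t)) * (1 + 2 * (v ξ t - u ξ t))
          ≤ Real.exp (2 * (u ξ t - v ξ t)) * Real.exp (2 * (v ξ t - u ξ t)) := by
            gcongr; linarith
        _ = 1 := by rw [← Real.exp_add, ← Real.exp_zero]; congr 1; ring
    have e5 : Real.exp (2 * (u ξ t - v ξ t)) ≤ 1 := Real.exp_le_one_iff.2 (by linarith)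
    generalize Real.exp (2 * (u ξ t - v ξ t)) = r at *
    generalize Real.exp (2 * u ξ t + -4 * v ξ t) = E at *
    generalize Real.exp (-2 * v ξ t) = G at *
    generalize Real.exp (-δ * v ξ t) = h at *
    generalize Real.exp (v ξ t) = e at *
    generalize v ξ t - u ξ t = z at *
    generalize Ds ρ (v - u) ξ t = y at *
    generalize Ds ρ v ξ t = b at *
    have hy : y = δ * b * z := by
      have : h * (y - δ * b * z) = 0 := by linarith
      have := (mul_eq_zero.1 this).resolve_left hh.ne'
      linarith
    -- lower bound for 1 - r
    have hr : 2 * z ≤ (1 - r) * (1 + 2 * Z) := by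
      have i1 : 2 * z ≤ (1 - r) * (1 + 2 * z) := by nlinarith
      have i2 : (1 - r) * (1 + 2 * z) ≤ (1 - r) * (1 + 2 * Z) := by
        apply mul_le_mul_of_nonneg_left _ (by linarith); linarith
      linarith
    have hr' : 2 * z * (δ * (1 + C0 ^ 2)) ≤ 1 - r := by
      have := mul_le_mul_of_nonneg_right hr (show 0 ≤ δ * (1 + C0 ^ 2) by positivity)
      nlinarith
    refine nonpos_of_mul_nonpos_right (a := e ^ 2) ?_ (by positivity)
    have key : -4 * (1 - r) + z * (δ * (4 - 2 * r) + δ ^ 2 * (e * b) ^ 2) ≤ 0 := by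
      have j1 : δ ^ 2 * (e * b) ^ 2 ≤ δ * C0 ^ 2 := by
        calc δ ^ 2 * (e * b) ^ 2 ≤ δ ^ 2 * C0 ^ 2 := by gcongr
          _ ≤ δ * C0 ^ 2 := by
            apply mul_le_mul_of_nonneg_right _ (sq_nonneg _); nlinarith
      have j2 : δ * (4 - 2 * r) ≤ 4 * δ := by nlinarith
      have j3 : z * (δ * (4 - 2 * r) + δ ^ 2 * (e * b) ^ 2) ≤ z * (4 * δ + δ * C0 ^ 2) :=
        mul_le_mul_of_nonneg_left (by linarith) hz.le
      have j4 : 0 ≤ z * δ := by positivity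
      have j5 : 0 ≤ z * δ * C0 ^ 2 := by positivity
      nlinarith
    have := mul_nonpos_of_nonneg_of_nonpos hh.le key
    refine le_trans (le_of_eq ?_) this
    subst hy e1
    linear_combination (-4 * h + 4 * δ * h * z) * e2)
  exact ⟨δ, hδ0, K, hK0, fun ξ t h0 h1 => hK ξ t h0 h1⟩

section
variable {ξ t : ℝ}
theorem Lw (F : Flow T ρ u v) (h0 : 0 < t) (h1 : t < T) :
    L ρ u v (u - v) ξ t = ((4 : ℝ) • (Ex ((-2 : ℝ) • v) - Ex ((2 : ℝ) • u + (-4 : ℝ) • v))) ξ t := by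
  rw [F.L_sub h0 h1 F.su F.sv, F.Lu ξ t h0 h1, F.Lv ξ t h0 h1]
  simp only [Pi.add_apply, Pi.sub_apply, Ex_apply, Pi.smul_apply, smul_eq_mul]
  ring

theorem Ly (F : Flow T ρ u v) (h0 : 0 < t) (h1 : t < T) :
    L ρ u v (Ds ρ (u - v)) ξ t = ((-8 : ℝ) • (Ds ρ v * (Ex ((-2 : ℝ) • v)
      - Ex ((2 : ℝ) • u + (-4 : ℝ) • v))) - (8 : ℝ) • (Ex ((2 : ℝ) • u + (-4 : ℝ) • v) *
        Ds ρ (u - v)) - (Ds ρ u * Ds ρ u + (2 : ℝ) • (Ds ρ v * Ds ρ v)) * Ds ρ (u - v)) ξ t := by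
  have su := F.su
  have sv := F.sv
  have hy : Ds ρ (u - v) ξ t = _ := F.D_sub h0 h1 su sv
  rw [F.L_D h0 h1 (su.sub sv), D_congr (fun x => F.Lw h0 h1)]
  simp (maxDischargeDepth := 20) only [F.D_smul h0 h1, F.D_ex h0 h1, F.D_add h0 h1,
    F.D_sub h0 h1, Sm.ex, Sm.add, Sm.sub, Sm.smul, su, sv]
  simp only [Pi.add_apply, Pi.sub_apply, Pi.mul_apply, Ex_apply, Pi.smul_apply, smul_eq_mul]
  simp only [hy]
  ring

theorem Lys (F : Flow T ρ u v) (h0 : 0 < t) (h1 : t < T) :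
    L ρ u v (Ds ρ (Ds ρ (u - v))) ξ t =
      -8 * (Ds ρ (Ds ρ v) ξ t * (Real.exp (-2 * v ξ t) - Real.exp (2 * u ξ t + -4 * v ξ t)))
      + 16 * (Ds ρ v ξ t * Ds ρ v ξ t *
          (Real.exp (-2 * v ξ t) - Real.exp (2 * u ξ t + -4 * v ξ t)))
      + 16 * (Ds ρ v ξ t * Real.exp (2 * u ξ t + -4 * v ξ t) * Ds ρ (u - v) ξ t)
      - 16 * (Real.exp (2 * u ξ t + -4 * v ξ t) * (Ds ρ u ξ t - 2 * Ds ρ v ξ t)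
          * Ds ρ (u - v) ξ t)
      - 8 * (Real.exp (2 * u ξ t + -4 * v ξ t) * Ds ρ (Ds ρ (u - v)) ξ t)
      - (2 * (Ds ρ u ξ t * Ds ρ (Ds ρ u) ξ t) + 4 * (Ds ρ v ξ t * Ds ρ (Ds ρ v) ξ t))
        * Ds ρ (u - v) ξ t
      - 2 * ((Ds ρ u ξ t * Ds ρ u ξ t + 2 * (Ds ρ v ξ t * Ds ρ v ξ t))
        * Ds ρ (Ds ρ (u - v)) ξ t) := by
  have su := F.su
  have sv := F.sv
  have sa := F.sD su
  have sb := F.sD sv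
  have sy := F.sD (su.sub sv)
  have hy : Ds ρ (u - v) ξ t = _ := F.D_sub h0 h1 su sv
  rw [F.L_D h0 h1 sy, D_congr (fun x => F.Ly h0 h1)]
  generalize hY : Ds ρ (u - v) = Y at *
  simp (maxDischargeDepth := 20) only [F.D_smul h0 h1, F.D_ex h0 h1, F.D_add h0 h1,
    F.D_sub h0 h1, F.D_mul h0 h1, Sm.ex, Sm.add, Sm.sub, Sm.smul, Sm.mul, su, sv, sa, sb, sy]
  simp only [Pi.add_apply, Pi.sub_apply, Pi.mul_apply, Ex_apply, Pi.smul_apply, smul_eq_mul]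
  rw [hy]
  ring
end

theorem ybd (F : Flow T ρ u v) (huv : ∀ ξ t, 0 ≤ t → t < T → u ξ t ≤ v ξ t) {δ C0 C1 C2 : ℝ}
    (hC0 : 0 < C0) (hC1 : 0 < C1) (hC2 : 0 < C2)
    (hab : ∀ ξ t, 0 ≤ t → t < T →
      |Real.exp (v ξ t) * Ds ρ u ξ t| ≤ C0 ∧ |Real.exp (v ξ t) * Ds ρ v ξ t| ≤ C0)
    (hαβ : ∀ ξ t, 0 ≤ t → t < T →
      |Real.exp (v ξ t) ^ 2 * Ds ρ (Ds ρ u) ξ t| ≤ C1 ∧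
      |Real.exp (v ξ t) ^ 2 * Ds ρ (Ds ρ v) ξ t| ≤ C1)
    (hz : ∀ ξ t, 0 ≤ t → t < T → Real.exp (-δ * v ξ t) * (v ξ t - u ξ t) ≤ C2) :
    ∃ C > 0, ∀ ξ t, 0 ≤ t → t < T →
      |Real.exp (-δ * v ξ t) * Real.exp (v ξ t) ^ 2 * Ds ρ (Ds ρ (u - v)) ξ t| ≤ C := by
  have su := F.su
  have sv := F.sv
  have sy := F.sD (su.sub sv)
  -- common facts
  have e3 : ∀ ξ t, 0 ≤ t → t < T →
      |Real.exp (v ξ t) ^ 2 * Real.exp (2 * u ξ t + -4 * v ξ t)| ≤ 1 := by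
    intro ξ t h0 h1
    rw [eE, abs_of_pos (Real.exp_pos _)]
    exact Real.exp_le_one_iff.2 (by linarith [huv ξ t h0 h1])
  have e4 : ∀ ξ t, 0 ≤ t → t < T → |Real.exp (-δ * v ξ t) *
      (Real.exp (v ξ t) ^ 2 * (Real.exp (-2 * v ξ t) - Real.exp (2 * u ξ t + -4 * v ξ t)))|
        ≤ 2 * C2 := by
    intro ξ t h0 h1
    rw [mul_sub (Real.exp (v ξ t) ^ 2), eE, eG]
    have hh := Real.exp_pos (-δ * v ξ t)
    have a1 : Real.exp (2 * (u ξ t - v ξ t)) ≤ 1 :=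
      Real.exp_le_one_iff.2 (by linarith [huv ξ t h0 h1])
    have a2 := Real.add_one_le_exp (2 * (u ξ t - v ξ t))
    rw [abs_of_nonneg (mul_nonneg hh.le (by linarith))]
    calc _ ≤ Real.exp (-δ * v ξ t) * (2 * (v ξ t - u ξ t)) := by gcongr; linarith
      _ ≤ _ := by linarith [hz ξ t h0 h1]
  have ew : ∀ ξ t, 0 ≤ t → t < T → |Real.exp (-δ * v ξ t) * (u - v) ξ t| ≤ C2 := by
    intro ξ t h0 h1
    have hh := Real.exp_pos (-δ * v ξ t)
    rw [abs_of_nonpos (mul_nonpos_of_nonneg_of_nonpos hh.le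
      (by simp only [Pi.sub_apply]; linarith [huv ξ t h0 h1]))]
    simp only [Pi.sub_apply]
    linarith [hz ξ t h0 h1]
  -- bound on Ly
  have hLy : ∀ ξ t, 0 < t → t < T →
      |Real.exp (-δ * v ξ t) * Real.exp (v ξ t) ^ 3 * L ρ u v (Ds ρ (u - v)) ξ t| ≤
      16 * C0 * C2 + (8 + 3 * C0 ^ 2) *
        |Real.exp (-δ * v ξ t) * Real.exp (v ξ t) * Ds ρ (u - v) ξ t| := by
    intro ξ t h0 h1
    rw [F.Ly h0 h1]
    obtain ⟨hA, hB⟩ := hab ξ t h0.le h1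
    have hy := le_refl |Real.exp (-δ * v ξ t) * Real.exp (v ξ t) * Ds ρ (u - v) ξ t|
    simp only [Pi.add_apply, Pi.sub_apply, Pi.mul_apply, Ex_apply, Pi.smul_apply, smul_eq_mul]
    have := subbd (subbd (cbd (-8) (mulbd hB (e4 ξ t h0.le h1)))
      (cbd 8 (mulbd (e3 ξ t h0.le h1) hy)))
      (mulbd (addbd (mulbd hA hA) (cbd 2 (mulbd hB hB))) hy)
    norm_num only [abs_neg, abs_two, Nat.abs_ofNat] at this
    refine le_trans (le_of_eq ?_) (this.trans (le_of_eq ?_))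
    · congr 1; ring
    · ring
  obtain ⟨C3, hC3, h3⟩ := F.bern δ (C0 + C2 + 8 * C2 + 16 * C0 * C2 + (8 + 3 * C0 ^ 2))
    (by positivity) (su.sub sv) (su.sub sv) huv
    (fun ξ t h0 h1 => (hab ξ t h0 h1).2.trans (by nlinarith [mul_pos hC0 hC2, sq_nonneg C0]))
    (fun ξ t h0 h1 => (ew ξ t h0 h1).trans (by nlinarith [mul_pos hC0 hC2, sq_nonneg C0]))
    (fun ξ t h0 h1 => (ew ξ t h0 h1).trans (by nlinarith [mul_pos hC0 hC2, sq_nonneg C0]))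
    (fun ξ t h0 h1 => by
      rw [F.Lw h0 h1]
      simp only [Pi.add_apply, Pi.sub_apply, Ex_apply, Pi.smul_apply, smul_eq_mul]
      have := cbd 4 (e4 ξ t h0.le h1)
      norm_num only [Nat.abs_ofNat] at this
      refine le_trans (le_of_eq ?_) (this.trans ?_)
      · congr 1; ring
      · nlinarith [mul_pos hC0 hC2, sq_nonneg C0])
    (fun ξ t h0 h1 => by
      rw [F.Lw h0 h1]
      simp only [Pi.add_apply, Pi.sub_apply, Ex_apply, Pi.smul_apply, smul_eq_mul]
      have := cbd 4 (e4 ξ t h0.le h1)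
      norm_num only [Nat.abs_ofNat] at this
      refine le_trans (le_of_eq ?_) (this.trans ?_)
      · congr 1; ring
      · nlinarith [mul_pos hC0 hC2, sq_nonneg C0])
    (fun ξ t h0 h1 => (hLy ξ t h0 h1).trans (by
      have := abs_nonneg (Real.exp (-δ * v ξ t) * Real.exp (v ξ t) * Ds ρ (u - v) ξ t)
      generalize |Real.exp (-δ * v ξ t) * Real.exp (v ξ t) * Ds ρ (u - v) ξ t| = x at *
      rw [← sub_nonneg]; ring_nf; positivity))
    (fun ξ t h0 h1 => (hLy ξ t h0 h1).trans (by
      have := abs_nonneg (Real.exp (-δ * v ξ t) * Real.exp (v ξ t) * Ds ρ (u - v) ξ t)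
      generalize |Real.exp (-δ * v ξ t) * Real.exp (v ξ t) * Ds ρ (u - v) ξ t| = x at *
      rw [← sub_nonneg]; ring_nf; positivity))
  have hm : ∀ ξ t, Real.exp (-(δ - 1) * v ξ t) = Real.exp (-δ * v ξ t) * Real.exp (v ξ t) := by
    intro ξ t; rw [← Real.exp_add]; congr 1; ring
  have hLy2 : ∀ ξ t, 0 < t → t < T →
      |Real.exp (-(δ - 1) * v ξ t) * Real.exp (v ξ t) ^ 2 * L ρ u v (Ds ρ (u - v)) ξ t| ≤
      16 * C0 * C2 + (8 + 3 * C0 ^ 2) * C3 := by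
    intro ξ t h0 h1
    rw [hm]
    refine le_trans (le_of_eq ?_) ((hLy ξ t h0 h1).trans ?_)
    · congr 1; ring
    · have := (h3 ξ t h0.le h1).1
      gcongr
  set Q := 16 * C1 * C2 + 32 * C0 ^ 2 * C2 + 64 * C0 * C3 + 6 * C0 * C1 * C3 with hQ
  have hQ0 : 0 < Q := by positivity
  have hLys : ∀ ξ t, 0 < t → t < T →
      |Real.exp (-(δ - 1) * v ξ t) * Real.exp (v ξ t) ^ 3 * L ρ u v (Ds ρ (Ds ρ (u - v))) ξ t| ≤
      Q + (8 + 6 * C0 ^ 2) *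
        |Real.exp (-(δ - 1) * v ξ t) * Real.exp (v ξ t) * Ds ρ (Ds ρ (u - v)) ξ t| := by
    intro ξ t h0 h1
    rw [F.Lys h0 h1, hm]
    obtain ⟨hA, hB⟩ := hab ξ t h0.le h1
    obtain ⟨hα, hβ⟩ := hαβ ξ t h0.le h1
    have hy := (h3 ξ t h0.le h1).1
    have hE := e3 ξ t h0.le h1
    have hG := e4 ξ t h0.le h1
    have hs := le_refl |Real.exp (-δ * v ξ t) * Real.exp (v ξ t) * Real.exp (v ξ t) *
      Ds ρ (Ds ρ (u - v)) ξ t|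
    have := subbd (subbd (subbd (subbd (addbd (addbd (cbd (-8) (mulbd hβ hG))
      (cbd 16 (mulbd (mulbd hB hB) hG))) (cbd 16 (mulbd (mulbd hB hE) hy)))
      (cbd 16 (mulbd (mulbd hE (subbd hA (cbd 2 hB))) hy))) (cbd 8 (mulbd hE hs)))
      (mulbd (addbd (cbd 2 (mulbd hA hα)) (cbd 4 (mulbd hB hβ))) hy))
      (cbd 2 (mulbd (addbd (mulbd hA hA) (cbd 2 (mulbd hB hB))) hs))
    norm_num only [abs_neg, abs_two, Nat.abs_ofNat] at this
    refine le_trans (le_of_eq ?_) (this.trans (le_of_eq ?_))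
    · congr 1; ring
    · rw [hQ]; ring
  have hfin : ∀ x : ℝ, 0 ≤ x → Q + (8 + 6 * C0 ^ 2) * x ≤
      (C0 + C3 + (16 * C0 * C2 + (8 + 3 * C0 ^ 2) * C3) + Q + (8 + 6 * C0 ^ 2)) * (1 + (x + x)) := by
    intro x hx
    have : 0 < C0 + C3 + (16 * C0 * C2 + (8 + 3 * C0 ^ 2) * C3) := by positivity
    have h6 : 0 < 8 + 6 * C0 ^ 2 := by positivity
    nlinarith [mul_nonneg this.le hx, mul_nonneg hQ0.le hx, mul_nonneg h6.le hx]
  obtain ⟨C4, hC4, h4⟩ := F.bern (δ - 1)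
    (C0 + C3 + (16 * C0 * C2 + (8 + 3 * C0 ^ 2) * C3) + Q + (8 + 6 * C0 ^ 2))
    (by positivity) sy sy huv
    (fun ξ t h0 h1 => (hab ξ t h0 h1).2.trans (by
      rw [← sub_nonneg]; ring_nf; positivity))
    (fun ξ t h0 h1 => by
      rw [hm]
      exact (h3 ξ t h0 h1).1.trans (by
        rw [← sub_nonneg]; ring_nf; positivity))
    (fun ξ t h0 h1 => by
      rw [hm]
      exact (h3 ξ t h0 h1).1.trans (by
        rw [← sub_nonneg]; ring_nf; positivity))
    (fun ξ t h0 h1 => (hLy2 ξ t h0 h1).trans (by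
      rw [← sub_nonneg]; ring_nf; positivity))
    (fun ξ t h0 h1 => (hLy2 ξ t h0 h1).trans (by
      rw [← sub_nonneg]; ring_nf; positivity))
    (fun ξ t h0 h1 => (hLys ξ t h0 h1).trans (hfin _ (abs_nonneg _)))
    (fun ξ t h0 h1 => (hLys ξ t h0 h1).trans (hfin _ (abs_nonneg _)))
  refine ⟨C4, hC4, fun ξ t h0 h1 => ?_⟩
  have := (h4 ξ t h0 h1).1
  rw [hm] at this
  refine le_trans (le_of_eq ?_) this
  congr 1; ring

/-- scalar curvature -/
def sc (ρ u v : ℝ → ℝ → ℝ) : ℝ → ℝ → ℝ :=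
  (4 : ℝ) • Ex ((-2 : ℝ) • v) - Ex ((2 : ℝ) • u + (-4 : ℝ) • v)
    - (Ds ρ (Ds ρ u) + (2 : ℝ) • Ds ρ (Ds ρ v))
    - (Ds ρ u * Ds ρ u + (3 : ℝ) • (Ds ρ v * Ds ρ v) + (2 : ℝ) • (Ds ρ u * Ds ρ v))

theorem ssc (F : Flow T ρ u v) : Sm T (sc ρ u v) := by
  have su := F.su
  have sv := F.sv
  have sa := F.sD su
  have sb := F.sD sv
  have sα := F.sD sa
  have sβ := F.sD sb
  unfold sc
  simp (maxDischargeDepth := 20) only [Sm.ex, Sm.add, Sm.sub, Sm.smul, Sm.mul, su, sv, sa, sb,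
    sα, sβ]

theorem L_sc (F : Flow T ρ u v) {ξ t : ℝ} (h0 : 0 < t) (h1 : t < T) :
    0 ≤ L ρ u v (sc ρ u v) ξ t := by
  have su := F.su
  have sv := F.sv
  have sa := F.sD su
  have sb := F.sD sv
  have sα := F.sD sa
  have sβ := F.sD sb
  unfold sc
  simp (maxDischargeDepth := 20) only [F.L_smul h0 h1, F.L_ex h0 h1, F.L_add h0 h1,
    F.L_sub h0 h1, F.L_mul h0 h1, Sm.ex, Sm.add, Sm.sub, Sm.smul, Sm.mul, su, sv, sa, sb, sα, sβ,
    F.Lα h0 h1, F.Lβ h0 h1, F.La h0 h1, F.Lb h0 h1, F.Lu ξ t h0 h1, F.Lv ξ t h0 h1,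
    F.D_smul h0 h1, F.D_add h0 h1]
  simp only [Pi.add_apply, Pi.sub_apply, Pi.mul_apply, Ex_apply, Pi.smul_apply, smul_eq_mul]
  generalize Real.exp (2 * u ξ t + -4 * v ξ t) = E
  generalize Real.exp (-2 * v ξ t) = G
  generalize Ds ρ (Ds ρ u) ξ t = α
  generalize Ds ρ (Ds ρ v) ξ t = β
  generalize Ds ρ u ξ t = a
  generalize Ds ρ v ξ t = b
  have : 0 ≤ ((α + a ^ 2 + 2 * (β + b ^ 2)) ^ 2 + (-(α + a ^ 2) + 2 * (E - a * b)) ^ 2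
    + 2 * (-(β + b ^ 2) + (E - a * b) + (4 * G - 3 * E - b ^ 2)) ^ 2) := by positivity
  refine this.trans (le_of_eq ?_)
  ring

theorem sc_bd (F : Flow T ρ u v) (Rm : ℝ) (hR : ∀ ξ, Rm ≤ sc ρ u v ξ 0) :
    ∀ ξ t, 0 ≤ t → t < T → Rm ≤ sc ρ u v ξ t := by
  intro ξ t h0 h1
  have := F.mp F.ssc.neg le_rfl (-Rm) 0 le_rfl (fun ξ => by simpa using hR ξ) (by
    intro ξ t h0 h1 _ _
    rw [F.L_neg h0 h1 F.ssc]
    linarith [F.L_sc (ξ := ξ) h0 h1]) ξ t h0 h1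
  simp at this
  exact this

end Flow

namespace Flow

theorem dec (F : Flow T ρ u v) {Z δ C2 C4 ε : ℝ} (hδ : 0 < δ) (hC2 : 0 < C2) (hC4 : 0 < C4)
    (hε : 0 < ε)
    (hZ : ∀ ξ t, 0 ≤ t → t < T → v ξ t - u ξ t ≤ Z)
    (hz : ∀ ξ t, 0 ≤ t → t < T → Real.exp (-δ * v ξ t) * (v ξ t - u ξ t) ≤ C2)
    (hy : ∀ ξ t, 0 ≤ t → t < T →
      |Real.exp (-δ * v ξ t) * Real.exp (v ξ t) ^ 2 * Ds ρ (Ds ρ (u - v)) ξ t| ≤ C4)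
    (hs : ∀ ξ t, 0 ≤ t → t < T → -(3 - ε) * Real.exp (-2 * v ξ t) ≤ sc ρ u v ξ t) :
    ∃ U : ℝ, ∀ ξ t, 0 < t → t < T → (∀ y, u ξ t ≤ u y t) → u ξ t < U →
      pdt u ξ t ≤ -(ε / 6) * Real.exp (-2 * v ξ t) := by
  refine ⟨Real.log (ε / (28 * C2 + 4 * C4)) / δ - Z, fun ξ t h0 h1 hm hU => ?_⟩
  have hq : 0 < ε / (28 * C2 + 4 * C4) := by positivity
  have hZ' := hZ ξ t h0.le h1
  have hz' := hz ξ t h0.le h1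
  have hy' := (abs_le.1 (hy ξ t h0.le h1)).2
  have hs' := hs ξ t h0.le h1
  have hdv : Real.exp (δ * v ξ t) ≤ ε / (28 * C2 + 4 * C4) := by
    rw [← Real.le_log_iff_exp_le hq]
    have : v ξ t ≤ Real.log (ε / (28 * C2 + 4 * C4)) / δ := by linarith
    rw [le_div_iff₀ hδ] at this
    linarith
  obtain ⟨m1, m2⟩ := F.at_max F.su.neg h0 h1 (ξ := ξ) (fun y => by simpa using hm y)
  rw [F.D_neg h0 h1 F.su] at m1
  have e2 : Ds ρ (Ds ρ (-u)) ξ t = Ds ρ (-(Ds ρ u)) ξ t := D_congr fun x => F.D_neg h0 h1 F.su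
  have ey : Ds ρ (Ds ρ (u - v)) ξ t = Ds ρ (Ds ρ u - Ds ρ v) ξ t :=
    D_congr fun x => F.D_sub h0 h1 F.su F.sv
  rw [F.D_sub h0 h1 (F.sD F.su) (F.sD F.sv)] at ey
  have a0 : Ds ρ u ξ t = 0 := by linarith
  have hL := F.Lu ξ t h0 h1
  simp only [L, a0] at hL
  simp only [sc, Pi.add_apply, Pi.sub_apply, Pi.mul_apply, Ex_apply, Pi.smul_apply, smul_eq_mul,
    a0] at hs'
  have e1 := eE (u ξ t) (v ξ t)
  have e2 := eG (v ξ t)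
  have e3 := Real.add_one_le_exp (2 * (u ξ t - v ξ t))
  have e4 : Real.exp (-δ * v ξ t) * Real.exp (δ * v ξ t) = 1 := by
    rw [← Real.exp_add, ← Real.exp_zero]; congr 1; ring
  have p1 := Real.exp_pos (δ * v ξ t)
  have p2 := Real.exp_pos (v ξ t)
  have p3 := Real.exp_pos (-δ * v ξ t)
  have p4 := Real.exp_pos (-2 * v ξ t)
  rw [ey] at hy'
  generalize Real.exp (2 * (u ξ t - v ξ t)) = r at *
  generalize Real.exp (2 * u ξ t + -4 * v ξ t) = E at *
  generalize Real.exp (-2 * v ξ t) = G at *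
  generalize Real.exp (-δ * v ξ t) = h at *
  generalize Real.exp (δ * v ξ t) = k at *
  generalize Real.exp (v ξ t) = e at *
  generalize Ds ρ (Ds ρ u) ξ t = α at *
  generalize Ds ρ (Ds ρ v) ξ t = β at *
  generalize Ds ρ v ξ t = b at *
  generalize pdt u ξ t = p at *
  have hG : 0 < G * e ^ 2 := by rw [mul_comm, e2]; norm_num
  -- z ≤ C2 k
  have z1 : v ξ t - u ξ t ≤ C2 * k := by
    have := mul_le_mul_of_nonneg_right hz' p1.le
    calc _ = h * (v ξ t - u ξ t) * k := by linear_combination -(v ξ t - u ξ t) * e4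
      _ ≤ _ := this
  have y1 : e ^ 2 * (α - β) ≤ C4 * k := by
    have := mul_le_mul_of_nonneg_right hy' p1.le
    calc _ = h * e ^ 2 * (α - β) * k := by linear_combination -(e ^ 2 * (α - β)) * e4
      _ ≤ _ := this
  have hk : (28 * C2 + 4 * C4) * k ≤ ε := by
    rw [le_div_iff₀ (by positivity)] at hdv; linarith
  have hs2 := mul_le_mul_of_nonneg_left hs' (sq_nonneg e)
  have bb : 0 ≤ (e * b) ^ 2 := sq_nonneg _
  have hα : 3 * (e ^ 2 * α) ≤ (7 - ε) - r + 2 * (C4 * k) := by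
    have : e ^ 2 * (-(3 - ε) * G) = -(3 - ε) := by linear_combination (-(3 - ε)) * e2
    rw [this] at hs2
    have : e ^ 2 * (4 * G - E - (α + 2 * β) - (0 * 0 + 3 * (b * b) + 2 * (0 * b)))
      = 4 - r - e ^ 2 * (α + 2 * β) - 3 * (e * b) ^ 2 := by linear_combination 4 * e2 - e1
    rw [this] at hs2
    nlinarith
  have hp : e ^ 2 * p = e ^ 2 * α - 2 * r := by linear_combination e ^ 2 * hL - 2 * e1
  have : e ^ 2 * p ≤ e ^ 2 * (-(ε / 6) * G) := by
    have : e ^ 2 * (-(ε / 6) * G) = -(ε / 6) := by linear_combination (-(ε / 6)) * e2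
    rw [this, hp]
    nlinarith
  exact le_of_mul_le_mul_left this (by positivity)

theorem low (F : Flow T ρ u v) {Z ε U : ℝ} (hε : 0 < ε)
    (hZ : ∀ ξ t, 0 ≤ t → t < T → v ξ t - u ξ t ≤ Z)
    (hU : ∀ ξ t, 0 < t → t < T → (∀ y, u ξ t ≤ u y t) → u ξ t < U →
      pdt u ξ t ≤ -(ε / 6) * Real.exp (-2 * v ξ t)) :
    ∃ c > 0, ∀ ξ t, 0 ≤ t → t < T → c * (T - t) ≤ Real.exp (2 * u ξ t) := by
  set c := ε / 6 * Real.exp (-2 * Z) with hc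
  have hc0 : 0 < c := by positivity
  have sφ := (F.su.smul 2).ex
  -- main claim
  have main : ∀ ξ0 t0, 0 < t0 → t0 < T → u ξ0 t0 < U → c * (T - t0) ≤ Real.exp (2 * u ξ0 t0) := by
    intro ξ0 t0 h0 h1 hlt
    by_contra! hcon
    have hφ0 := Real.exp_pos (2 * u ξ0 t0)
    set φ0 := Real.exp (2 * u ξ0 t0) with hφ0d
    set t1 := t0 + φ0 / c with ht1
    have ht1c : c * (t1 - t0) = φ0 := by rw [ht1]; field_simp; ring
    have ht01 : t0 < t1 := by rw [ht1]; have := div_pos hφ0 hc0; linarith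
    have ht1T : t1 < T := by
      have : c * (t1 - t0) < c * (T - t0) := by rw [ht1c]; exact hcon
      have := lt_of_mul_lt_mul_left this hc0.le
      linarith
    set S : Set ℝ := {t | ∃ ξ ∈ Icc 0 (2 * π), Real.exp (2 * u ξ t) ≤ φ0 - c * (t - t0)} with hS
    have hK : IsClosed (S ∩ Icc t0 t1) := by
      set A : Set (ℝ × ℝ) := Icc 0 (2 * π) ×ˢ Icc t0 t1 with hA
      have hAc : IsCompact A := isCompact_Icc.prod isCompact_Icc
      have hcont : ContinuousOn (fun p : ℝ × ℝ =>
          Ex ((2 : ℝ) • u) p.1 p.2 + c * (p.2 - t0)) A := by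
        refine (sφ.contOn.mono ?_).add (by fun_prop)
        rintro ⟨x, t⟩ ⟨_, ht⟩
        exact ⟨trivial, h0.le.trans ht.1, ht.2.trans_lt ht1T⟩
      have hB : IsClosed (A ∩ (fun p : ℝ × ℝ =>
          Ex ((2 : ℝ) • u) p.1 p.2 + c * (p.2 - t0)) ⁻¹' Iic φ0) :=
        hcont.preimage_isClosed_of_isClosed hAc.isClosed isClosed_Iic
      have hBc := (hAc.of_isClosed_subset hB inter_subset_left).image continuous_snd
      convert hBc.isClosed using 1
      ext t
      constructor
      · rintro ⟨⟨ξ, hξ, h⟩, ht⟩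
        refine ⟨(ξ, t), ⟨⟨hξ, ht⟩, ?_⟩, rfl⟩
        simp [Ex]
        linarith
      · rintro ⟨⟨ξ, t'⟩, ⟨⟨hξ, ht⟩, h⟩, rfl⟩
        simp [Ex] at h
        exact ⟨⟨ξ, hξ, by simp only []; linarith⟩, ht⟩
    have hst : t0 ∈ S := by
      obtain ⟨x, hx, e⟩ := F.su.per t0 ξ0
      exact ⟨x, hx, by rw [← e]; simp [hφ0d]⟩
    have hsub := hK.Icc_subset_of_forall_exists_gt hst (by
      rintro t ⟨⟨ξ, hξ, h⟩, ht⟩ y hy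
      have htp : 0 < t := h0.trans_le ht.1
      have htT : t < T := ht.2.trans ht1T
      obtain ⟨x', hx'⟩ := F.su.neg.exists_max htp.le htT
      obtain ⟨x, hx, ex⟩ := F.su.per t x'
      have hmin : ∀ y, u x t ≤ u y t := by
        intro y; rw [← ex]; simpa using hx' y
      have hval : Real.exp (2 * u x t) ≤ φ0 - c * (t - t0) :=
        (Real.exp_le_exp.2 (by linarith [hmin ξ])).trans h
      have hxU : u x t < U := by
        have : Real.exp (2 * u x t) ≤ φ0 := hval.trans (by nlinarith [ht.1])
        have := Real.exp_le_exp.1 this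
        linarith
      have hd := hU x t htp htT hmin hxU
      have hD : HasDerivAt (fun τ => Real.exp (2 * u x τ))
        (Real.exp (2 * u x t) * (2 * pdt u x t)) t := ((F.su.hasPdt htp htT).const_mul 2).exp
      have hneg : Real.exp (2 * u x t) * (2 * pdt u x t) < -c := by
        have i1 : Real.exp (2 * u x t) * Real.exp (-2 * v x t) ≥ Real.exp (-2 * Z) := by
          rw [← Real.exp_add]
          exact Real.exp_le_exp.2 (by linarith [hZ x t htp.le htT])
        have i2 := mul_le_mul_of_nonneg_left hd (Real.exp_pos (2 * u x t)).le
        have i3 := Real.exp_pos (-2 * Z)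
        rw [hc]
        nlinarith
      have hev := (hasDerivAt_iff_tendsto_slope.1 hD).eventually_lt_const hneg
      have hev2 : ∀ᶠ s in 𝓝[>] t, slope (fun τ => Real.exp (2 * u x τ)) t s < -c :=
        hev.filter_mono (nhdsWithin_mono _ (fun s hs => ne_of_gt hs))
      obtain ⟨s, hs1, hs2⟩ := (hev2.and (Ioc_mem_nhdsGT hy)).exists
      refine ⟨s, ⟨x, hx, ?_⟩, hs2⟩
      have hts : 0 < s - t := sub_pos.2 hs2.1
      rw [slope_def_field, div_lt_iff₀ hts] at hs1
      linarith)
    obtain ⟨ξ, _, h⟩ := hsub ⟨ht01.le, le_rfl⟩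
    have := Real.exp_pos (2 * u ξ t1)
    linarith
  set d := min c (Real.exp (2 * U) / T) with hd
  have hT := F.T_pos
  have hd0 : 0 < d := lt_min hc0 (by positivity)
  have pos : ∀ ξ t, 0 < t → t < T → d * (T - t) ≤ Real.exp (2 * u ξ t) := by
    intro ξ t h0 h1
    rcases lt_or_ge (u ξ t) U with h | h
    · exact (mul_le_mul_of_nonneg_right (min_le_left _ _) (by linarith)).trans (main ξ t h0 h1 h)
    · calc d * (T - t) ≤ Real.exp (2 * U) / T * (T - t) :=
            mul_le_mul_of_nonneg_right (min_le_right _ _) (by linarith)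
        _ ≤ Real.exp (2 * U) / T * T := by gcongr; linarith
        _ = Real.exp (2 * U) := by field_simp
        _ ≤ _ := Real.exp_le_exp.2 (by linarith)
  refine ⟨d, hd0, fun ξ t h0 h1 => ?_⟩
  rcases h0.eq_or_lt with rfl | h0
  · have hcw : ContinuousWithinAt (fun τ => Ex ((2 : ℝ) • u) ξ τ) (Ico 0 T) 0 := by
      have := sφ.contOn (ξ, 0) ⟨trivial, le_rfl, h1⟩
      exact this.comp (f := fun τ => (ξ, τ)) (by fun_prop) (fun τ hτ => ⟨trivial, hτ⟩)
    have hcw2 := hcw.mono (Ioo_subset_Ico_self)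
    have hne : (𝓝[Ioo 0 T] (0 : ℝ)).NeBot := left_nhdsWithin_Ioo_neBot h1
    have hl : Tendsto (fun τ => d * (T - τ)) (𝓝[Ioo 0 T] (0 : ℝ)) (𝓝 (d * (T - 0))) :=
      (by fun_prop : Continuous fun τ => d * (T - τ)).continuousWithinAt
    exact le_of_tendsto_of_tendsto hl hcw2
      (eventually_nhdsWithin_of_forall fun τ hτ => pos ξ τ hτ.1 hτ.2)
  · exact pos ξ t h0 h1

theorem upp (F : Flow T ρ u v) (huv : ∀ ξ t, 0 ≤ t → t < T → u ξ t ≤ v ξ t)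
    (hb : ∀ η t0 : ℝ, 0 ≤ t0 → t0 < T → ∃ ξ t, t0 < t ∧ t < T ∧ v ξ t < η)
    (t0 m : ℝ) (h0 : 0 ≤ t0) (h1 : t0 < T) (hm : ∀ ξ, m ≤ Real.exp (2 * u ξ t0)) :
    m ≤ 4 * (T - t0) := by
  by_contra! hcon
  have hd : 0 < m - 4 * (T - t0) := by linarith
  obtain ⟨ξ, t, ht0, htT, hv⟩ := hb (Real.log (m - 4 * (T - t0)) / 2) t0 h0 h1
  have := F.mp (F.su.smul 2).ex.neg h0 (-m) 4 (by norm_num)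
    (fun ξ => by simpa [Ex] using hm ξ) (by
      intro ξ t ht0 htT _ hD
      have h0' := h0.trans_lt ht0
      rw [F.D_neg h0' htT (F.su.smul 2).ex, F.D_ex h0' htT (F.su.smul 2),
        F.D_smul h0' htT F.su] at hD
      rw [F.L_neg h0' htT (F.su.smul 2).ex, F.L_ex h0' htT (F.su.smul 2),
        F.L_smul h0' htT F.su, F.D_smul h0' htT F.su, F.Lu ξ t h0' htT]
      have hD' : Ds ρ u ξ t = 0 := by
        have := Real.exp_pos (((2 : ℝ) • u) ξ t)
        simpa using hD
      have : Real.exp (((2 : ℝ) • u) ξ t) * Real.exp (2 * u ξ t + -4 * v ξ t) ≤ 1 := by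
        rw [← Real.exp_add, Real.exp_le_one_iff]
        simp only [Pi.smul_apply, smul_eq_mul]
        linarith [huv ξ t h0'.le htT]
      rw [hD']
      linarith) ξ t ht0.le htT
  simp only [Pi.neg_apply, Ex_apply, Pi.smul_apply, smul_eq_mul] at this
  have h3 : Real.exp (2 * u ξ t) < m - 4 * (T - t0) := by
    rw [← Real.lt_log_iff_exp_lt hd]
    linarith [huv ξ t (h0.trans ht0.le) htT]
  linarith

end Flow

section conv
variable {ξ t : ℝ}

theorem sDs (sρ : Sm T ρ) (hρ : ∀ ξ t : ℝ, 0 ≤ t → t < T → 0 < ρ ξ t) (h : Sm T φ) :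
    Sm T (Ds ρ φ) := by
  refine ⟨h.pd1.1.div sρ.1 ?_, fun ξ t => ?_⟩
  · rintro ⟨ξ, t⟩ ⟨_, h0, h1⟩
    exact (hρ ξ t h0 h1).ne'
  · simp [Ds, h.pd1.2, sρ.2]

theorem D_exp (h0 : 0 ≤ t) (h1 : t < T) (h : Sm T φ) (hψ : ∀ x, ψ x t = Real.exp (φ x t)) :
    Ds ρ ψ ξ t = Real.exp (φ ξ t) * Ds ρ φ ξ t := by
  have e : Ds ρ ψ ξ t = Ds ρ (Ex φ) ξ t := Flow.D_congr fun x => hψ x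
  have : pd1 (Ex φ) ξ t = _ := (h.hasPd1 h0 h1).exp.deriv
  rw [e]
  simp only [Ds, this]; ring

theorem DD_exp (h0 : 0 ≤ t) (h1 : t < T) (sρ : Sm T ρ)
    (hρ : ∀ ξ t : ℝ, 0 ≤ t → t < T → 0 < ρ ξ t) (h : Sm T φ)
    (hψ : ∀ x, ψ x t = Real.exp (φ x t)) :
    Ds ρ (Ds ρ ψ) ξ t = Real.exp (φ ξ t) * (Ds ρ (Ds ρ φ) ξ t + Ds ρ φ ξ t ^ 2) := by
  have e : Ds ρ (Ds ρ ψ) ξ t = Ds ρ (Ex φ * Ds ρ φ) ξ t :=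
    Flow.D_congr fun x => D_exp h0 h1 h hψ
  have e1 : pd1 (Ex φ * Ds ρ φ) ξ t = _ :=
    ((h.hasPd1 h0 h1).exp.mul ((sDs sρ hρ h).hasPd1 h0 h1)).deriv
  rw [e, Ds, e1]
  simp only [Ds]; ring
end conv

section main
variable {f g : ℝ → ℝ → ℝ}

/-- logarithm of a function -/
def lg (f : ℝ → ℝ → ℝ) : ℝ → ℝ → ℝ := fun ξ t => Real.log (f ξ t)

theorem smf (sol : WarpedBerger T f g ρ) : Sm T f := ⟨sol.smooth.fst, sol.f_per⟩
theorem smg (sol : WarpedBerger T f g ρ) : Sm T g := ⟨sol.smooth.snd.fst, sol.g_per⟩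
theorem smρ (sol : WarpedBerger T f g ρ) : Sm T ρ := ⟨sol.smooth.snd.snd, sol.ρ_per⟩

theorem Sm.lg (h : Sm T φ) (hp : ∀ ξ t : ℝ, 0 ≤ t → t < T → 0 < φ ξ t) : Sm T (lg φ) :=
  ⟨h.1.log (fun p hp' => (hp p.1 p.2 hp'.2.1 hp'.2.2).ne'), fun ξ t => by simp [WB.lg, h.2]⟩

theorem exp_lg (hp : ∀ ξ t : ℝ, 0 ≤ t → t < T → 0 < φ ξ t) {ξ t : ℝ} (h0 : 0 ≤ t) (h1 : t < T) :
    φ ξ t = Real.exp (lg φ ξ t) := (Real.exp_log (hp ξ t h0 h1)).symm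

theorem pdt_lg (h : Sm T φ) (hp : ∀ ξ t : ℝ, 0 ≤ t → t < T → 0 < φ ξ t) {ξ t : ℝ}
    (h0 : 0 < t) (h1 : t < T) : pdt (lg φ) ξ t = pdt φ ξ t / φ ξ t :=
  ((h.hasPdt h0 h1).log (hp ξ t h0.le h1).ne').deriv

theorem mkFlow (sol : WarpedBerger T f g ρ) : Flow T ρ (lg f) (lg g) := by
  have sf := smf sol
  have sg := smg sol
  have sρ := smρ sol
  have su := sf.lg sol.f_pos
  have sv := sg.lg sol.g_pos
  have fe : ∀ ξ t, 0 < t → t < T → Real.exp (2 * lg f ξ t + -4 * lg g ξ t) =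
      f ξ t ^ 2 / g ξ t ^ 4 := by
    intro ξ t h0 h1
    rw [Real.exp_add, exp_lg sol.f_pos h0.le h1, exp_lg sol.g_pos h0.le h1, ← Real.exp_nat_mul,
      ← Real.exp_nat_mul, div_eq_mul_inv, ← Real.exp_neg]
    simp [lg]
  have ge : ∀ ξ t, 0 < t → t < T → Real.exp (-2 * lg g ξ t) = 1 / g ξ t ^ 2 := by
    intro ξ t h0 h1
    rw [exp_lg sol.g_pos h0.le h1, ← Real.exp_nat_mul, one_div, ← Real.exp_neg]
    simp [lg]
  have Df : ∀ ξ t, 0 < t → t < T → Ds ρ f ξ t = f ξ t * Ds ρ (lg f) ξ t := by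
    intro ξ t h0 h1
    rw [exp_lg sol.f_pos h0.le h1]
    exact D_exp h0.le h1 su (fun x => exp_lg sol.f_pos h0.le h1)
  have Dg : ∀ ξ t, 0 < t → t < T → Ds ρ g ξ t = g ξ t * Ds ρ (lg g) ξ t := by
    intro ξ t h0 h1
    rw [exp_lg sol.g_pos h0.le h1]
    exact D_exp h0.le h1 sv (fun x => exp_lg sol.g_pos h0.le h1)
  have DDf : ∀ ξ t, 0 < t → t < T → Ds ρ (Ds ρ f) ξ t =
      f ξ t * (Ds ρ (Ds ρ (lg f)) ξ t + Ds ρ (lg f) ξ t ^ 2) := by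
    intro ξ t h0 h1
    rw [exp_lg sol.f_pos h0.le h1]
    exact DD_exp h0.le h1 sρ sol.ρ_pos su (fun x => exp_lg sol.f_pos h0.le h1)
  have DDg : ∀ ξ t, 0 < t → t < T → Ds ρ (Ds ρ g) ξ t =
      g ξ t * (Ds ρ (Ds ρ (lg g)) ξ t + Ds ρ (lg g) ξ t ^ 2) := by
    intro ξ t h0 h1
    rw [exp_lg sol.g_pos h0.le h1]
    exact DD_exp h0.le h1 sρ sol.ρ_pos sv (fun x => exp_lg sol.g_pos h0.le h1)
  refine ⟨sol.T_pos, su, sv, sρ, sol.ρ_pos, ?_, ?_, ?_⟩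
  · intro ξ t h0 h1
    have hf := sol.f_pos ξ t h0.le h1
    have hg := sol.g_pos ξ t h0.le h1
    rw [L, pdt_lg sf sol.f_pos h0 h1, sol.eq_f ξ t h0 h1, fe ξ t h0 h1, DDf ξ t h0 h1,
      Df ξ t h0 h1, Dg ξ t h0 h1]
    field_simp
    ring
  · intro ξ t h0 h1
    have hf := sol.f_pos ξ t h0.le h1
    have hg := sol.g_pos ξ t h0.le h1
    rw [L, pdt_lg sg sol.g_pos h0 h1, sol.eq_g ξ t h0 h1, fe ξ t h0 h1, ge ξ t h0 h1,
      DDg ξ t h0 h1, Df ξ t h0 h1, Dg ξ t h0 h1]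
    field_simp
    ring
  · intro ξ t h0 h1
    have hf := sol.f_pos ξ t h0.le h1
    have hg := sol.g_pos ξ t h0.le h1
    have hr := sol.ρ_pos ξ t h0.le h1
    have h2 : pdt (lg ρ) ξ t = _ := sol.eq_ρ ξ t h0 h1
    rw [pdt_lg sρ sol.ρ_pos h0 h1, DDf ξ t h0 h1, DDg ξ t h0 h1,
      mul_div_cancel_left₀ _ hf.ne', mul_div_cancel_left₀ _ hg.ne'] at h2
    rw [← h2]; field_simp

theorem curv (sol : WarpedBerger T f g ρ) {ξ t : ℝ} (h0 : 0 ≤ t) (h1 : t < T) :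
    k01 ρ f ξ t = -(Ds ρ (Ds ρ (lg f)) ξ t + Ds ρ (lg f) ξ t ^ 2) ∧
    k02 ρ g ξ t = -(Ds ρ (Ds ρ (lg g)) ξ t + Ds ρ (lg g) ξ t ^ 2) ∧
    k12 ρ f g ξ t = Real.exp (2 * lg f ξ t + -4 * lg g ξ t) - Ds ρ (lg f) ξ t * Ds ρ (lg g) ξ t ∧
    k23 ρ f g ξ t = 4 * Real.exp (-2 * lg g ξ t) - 3 * Real.exp (2 * lg f ξ t + -4 * lg g ξ t)
      - Ds ρ (lg g) ξ t ^ 2 := by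
  have F := mkFlow sol
  have hf := sol.f_pos ξ t h0 h1
  have hg := sol.g_pos ξ t h0 h1
  have fe : Real.exp (2 * lg f ξ t + -4 * lg g ξ t) = f ξ t ^ 2 / g ξ t ^ 4 := by
    rw [Real.exp_add, exp_lg sol.f_pos h0 h1, exp_lg sol.g_pos h0 h1, ← Real.exp_nat_mul,
      ← Real.exp_nat_mul, div_eq_mul_inv, ← Real.exp_neg]
    simp [lg]
  have ge : Real.exp (-2 * lg g ξ t) = 1 / g ξ t ^ 2 := by
    rw [exp_lg sol.g_pos h0 h1, ← Real.exp_nat_mul, one_div, ← Real.exp_neg]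
    simp [lg]
  have Df : Ds ρ f ξ t = Real.exp (lg f ξ t) * Ds ρ (lg f) ξ t :=
    D_exp h0 h1 F.su (fun x => exp_lg sol.f_pos h0 h1)
  have Dg : Ds ρ g ξ t = Real.exp (lg g ξ t) * Ds ρ (lg g) ξ t :=
    D_exp h0 h1 F.sv (fun x => exp_lg sol.g_pos h0 h1)
  have DDf : Ds ρ (Ds ρ f) ξ t = _ :=
    DD_exp h0 h1 F.sρ sol.ρ_pos F.su (fun x => exp_lg sol.f_pos h0 h1)
  have DDg : Ds ρ (Ds ρ g) ξ t = _ :=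
    DD_exp h0 h1 F.sρ sol.ρ_pos F.sv (fun x => exp_lg sol.g_pos h0 h1)
  rw [← exp_lg sol.f_pos h0 h1] at Df DDf
  rw [← exp_lg sol.g_pos h0 h1] at Dg DDg
  refine ⟨?_, ?_, ?_, ?_⟩
  · rw [k01, DDf]; field_simp
  · rw [k02, DDg]; field_simp
  · rw [k12, Df, Dg, fe]; field_simp
  · rw [k23, Dg, fe, ge]; field_simp

theorem scalR_eq (sol : WarpedBerger T f g ρ) {ξ t : ℝ} (h0 : 0 ≤ t) (h1 : t < T) :
    scalR ρ f g ξ t = Flow.sc ρ (lg f) (lg g) ξ t := by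
  obtain ⟨e1, e2, e3, e4⟩ := curv sol (ξ := ξ) h0 h1
  rw [scalR, e1, e2, e3, e4]
  simp only [Flow.sc, Pi.add_apply, Pi.sub_apply, Pi.mul_apply, Ex_apply, Pi.smul_apply,
    smul_eq_mul]
  ring

theorem scal_low (sol : AssumptionA T f g ρ)
    (huv : ∀ ξ t, 0 ≤ t → t < T → lg f ξ t ≤ lg g ξ t) :
    ∃ ε > 0, ∀ ξ t, 0 ≤ t → t < T →
      -(3 - ε) * Real.exp (-2 * lg g ξ t) ≤ Flow.sc ρ (lg f) (lg g) ξ t := by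
  have W := sol.toWarpedBerger
  have F := mkFlow W
  have hT := F.T_pos
  have hi := sol.init_scalar
  set Rm := ⨅ ξ : ℝ, scalR ρ f g ξ 0 with hRm
  set Gm := ⨆ ξ : ℝ, (g ξ 0) ^ 2 with hGm
  have bR : BddBelow (range fun ξ => scalR ρ f g ξ 0) := by
    obtain ⟨x, hx⟩ := F.ssc.neg.exists_max le_rfl hT
    refine ⟨scalR ρ f g x 0, ?_⟩
    rintro _ ⟨ξ, rfl⟩
    simp only [scalR_eq W le_rfl hT]
    simpa using hx ξ
  have bG : BddAbove (range fun ξ => (g ξ 0) ^ 2) := by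
    obtain ⟨x, hx⟩ := (smg W).exists_max le_rfl hT
    refine ⟨g x 0 ^ 2, ?_⟩
    rintro _ ⟨ξ, rfl⟩
    have := W.g_pos ξ 0 le_rfl hT
    have := hx ξ
    simp only []
    gcongr
  have hR : ∀ ξ, Rm ≤ Flow.sc ρ (lg f) (lg g) ξ 0 := fun ξ => by
    rw [← scalR_eq W le_rfl hT]; exact ciInf_le bR ξ
  have hG : ∀ ξ, g ξ 0 ^ 2 ≤ Gm := fun ξ => le_ciSup bG ξ
  have hGp : 0 < Gm := (pow_pos (W.g_pos 0 0 le_rfl hT) 2).trans_le (hG 0)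
  have hv := F.vbd huv (Real.log Gm / 2) (fun ξ => by
    have := Real.log_le_log (pow_pos (W.g_pos ξ 0 le_rfl hT) 2) (hG ξ)
    rw [Real.log_pow] at this
    simp only [lg]; push_cast at this; linarith)
  have hsc := F.sc_bd Rm hR
  refine ⟨min 3 (Rm * Gm + 3), lt_min (by norm_num) (by linarith), fun ξ t h0 h1 => ?_⟩
  have hs := hsc ξ t h0 h1
  refine le_trans ?_ hs
  have hE := Real.exp_pos (-2 * lg g ξ t)
  have h3 := min_le_left 3 (Rm * Gm + 3)
  have h4 := min_le_right 3 (Rm * Gm + 3)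
  generalize min 3 (Rm * Gm + 3) = ε at *
  rcases le_or_gt 0 Rm with hp | hp
  · nlinarith
  · have : 1 ≤ Gm * Real.exp (-2 * lg g ξ t) := by
      calc (1 : ℝ) = Gm * Real.exp (-Real.log Gm) := by
            rw [Real.exp_neg, Real.exp_log hGp]; field_simp
        _ ≤ _ := by
            gcongr
            linarith [hv ξ t h0 h1]
    nlinarith

theorem final (sol : AssumptionA T f g ρ) :
    ∃ c C : ℝ, 0 < c ∧
      (∀ t : ℝ, 0 ≤ t → t < T →
        c * Real.sqrt (T - t) ≤ Mcheck f g t ∧ Mcheck f g t ≤ C * Real.sqrt (T - t)) ∧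
      (∀ ξ t : ℝ, 0 ≤ t → t < T →
        |k01 ρ f ξ t| + 2 * |k02 ρ g ξ t| + 2 * |k12 ρ f g ξ t| + |k23 ρ f g ξ t|
          ≤ C / (T - t)) := by
  have W := sol.toWarpedBerger
  have F := mkFlow W
  have hT := F.T_pos
  have huv := F.ord (fun ξ => Real.log_le_log (W.f_pos ξ 0 le_rfl hT) (sol.init_order ξ))
  obtain ⟨Z, hZ0, hZ⟩ := F.zbd huv
  obtain ⟨C0, hC0, hab⟩ := F.ab huv
  obtain ⟨C1, hC1, hαβ⟩ := F.αβ huv hC0 hab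
  obtain ⟨δ, hδ, C2, hC2, hz⟩ := F.δbd huv hZ0 hC0 hZ hab
  obtain ⟨C4, hC4, hy⟩ := F.ybd huv hC0 hC1 hC2 hab hαβ hz
  obtain ⟨ε, hε, hs⟩ := scal_low sol huv
  obtain ⟨U, hU⟩ := F.dec hδ hC2 hC4 hε hZ hz hy hs
  obtain ⟨c, hc, hlow⟩ := F.low hε hZ hU
  -- curvature bound
  set K := C1 + C0 ^ 2 + 1 + 7 + C0 ^ 2 with hK
  have hK0 : 0 < K := by positivity
  have hcurv : ∀ ξ t, 0 ≤ t → t < T → Real.exp (lg g ξ t) ^ 2 * |k01 ρ f ξ t| ≤ K ∧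
      Real.exp (lg g ξ t) ^ 2 * |k02 ρ g ξ t| ≤ K ∧
      Real.exp (lg g ξ t) ^ 2 * |k12 ρ f g ξ t| ≤ K ∧
      Real.exp (lg g ξ t) ^ 2 * |k23 ρ f g ξ t| ≤ K := by
    intro ξ t h0 h1
    obtain ⟨e1, e2, e3, e4⟩ := curv W (ξ := ξ) h0 h1
    obtain ⟨hA, hB⟩ := hab ξ t h0 h1
    obtain ⟨hα, hβ⟩ := hαβ ξ t h0 h1
    have sqd : ∀ x, Real.exp (lg g ξ t) ^ 2 * |x| = |Real.exp (lg g ξ t) ^ 2 * x| := by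
      intro x; rw [abs_mul, abs_of_pos (pow_pos (Real.exp_pos _) 2)]
    have hE : |Real.exp (lg g ξ t) ^ 2 * Real.exp (2 * lg f ξ t + -4 * lg g ξ t)| ≤ 1 := by
      rw [eE, abs_of_pos (Real.exp_pos _)]
      exact Real.exp_le_one_iff.2 (by linarith [huv ξ t h0 h1])
    have hG : |Real.exp (lg g ξ t) ^ 2 * Real.exp (-2 * lg g ξ t)| ≤ 1 := by
      rw [eG]; norm_num
    have hsq := sq_nonneg C0
    rw [e1, e2, e3, e4]
    simp only [sqd]
    refine ⟨?_, ?_, ?_, ?_⟩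
    · have := cbd (-1) (addbd hα (mulbd hA hA))
      norm_num only [abs_neg, abs_one] at this
      refine le_trans (le_of_eq ?_) (this.trans ?_)
      · congr 1; ring
      · rw [hK]; nlinarith
    · have := cbd (-1) (addbd hβ (mulbd hB hB))
      norm_num only [abs_neg, abs_one] at this
      refine le_trans (le_of_eq ?_) (this.trans ?_)
      · congr 1; ring
      · rw [hK]; nlinarith
    · have := subbd hE (mulbd hA hB)
      refine le_trans (le_of_eq ?_) (this.trans ?_)
      · congr 1; ring
      · rw [hK]; nlinarith
    · have := subbd (subbd (cbd 4 hG) (cbd 3 hE)) (mulbd hB hB)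
      norm_num only [Nat.abs_ofNat] at this
      refine le_trans (le_of_eq ?_) (this.trans ?_)
      · congr 1; ring
      · rw [hK]; nlinarith
  have hb : ∀ η t0 : ℝ, 0 ≤ t0 → t0 < T → ∃ ξ t, t0 < t ∧ t < T ∧ lg g ξ t < η := by
    intro η t0 h0 h1
    obtain ⟨ξ, t, ht0, htT, hlt⟩ := sol.ricci_blowup (9 * K * Real.exp (-2 * η)) t0 h0 h1
    refine ⟨ξ, t, ht0, htT, ?_⟩
    by_contra! hge
    obtain ⟨c1, c2, c3, c4⟩ := hcurv ξ t (h0.trans ht0.le) htT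
    have a1 : |k01 ρ f ξ t + 2 * k12 ρ f g ξ t| ≤ |k01 ρ f ξ t| + 2 * |k12 ρ f g ξ t| := by
      have := abs_add_le (k01 ρ f ξ t) (2 * k12 ρ f g ξ t)
      rwa [abs_mul, abs_two] at this
    have a2 : |k01 ρ f ξ t + 2 * k02 ρ g ξ t| ≤ |k01 ρ f ξ t| + 2 * |k02 ρ g ξ t| := by
      have := abs_add_le (k01 ρ f ξ t) (2 * k02 ρ g ξ t)
      rwa [abs_mul, abs_two] at this
    have a3 := abs_add_three (k02 ρ g ξ t) (k12 ρ f g ξ t) (k23 ρ f g ξ t)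
    have hp := Real.exp_pos (lg g ξ t)
    have e2 := eG (lg g ξ t)
    have hle : Real.exp (-2 * lg g ξ t) ≤ Real.exp (-2 * η) := Real.exp_le_exp.2 (by linarith)
    set P := |k01 ρ f ξ t + 2 * k12 ρ f g ξ t| + |k01 ρ f ξ t + 2 * k02 ρ g ξ t|
        + |k02 ρ g ξ t + k12 ρ f g ξ t + k23 ρ f g ξ t| with hP
    have hP9 : Real.exp (lg g ξ t) ^ 2 * P ≤ 9 * K := by
      have : P ≤ 2 * |k01 ρ f ξ t| + 3 * |k02 ρ g ξ t| + 3 * |k12 ρ f g ξ t|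
        + |k23 ρ f g ξ t| := by linarith
      have := mul_le_mul_of_nonneg_left this (pow_pos hp 2).le
      linarith
    have h9 := mul_le_mul_of_nonneg_right hP9 (Real.exp_pos (-2 * lg g ξ t)).le
    have : Real.exp (lg g ξ t) ^ 2 * P * Real.exp (-2 * lg g ξ t) = P := by
      linear_combination P * e2
    rw [this] at h9
    have : 9 * K * Real.exp (-2 * lg g ξ t) ≤ 9 * K * Real.exp (-2 * η) := by gcongr
    linarith
  have hexp : ∀ ξ t, 0 ≤ t → t < T → Real.exp (2 * lg f ξ t) = f ξ t ^ 2 := by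
    intro ξ t h0 h1
    rw [exp_lg W.f_pos h0 h1, ← Real.exp_nat_mul]
    simp [lg]
  have hfg : ∀ ξ t, 0 ≤ t → t < T → f ξ t ≤ g ξ t := by
    intro ξ t h0 h1
    rw [exp_lg W.f_pos h0 h1, exp_lg W.g_pos h0 h1]
    exact Real.exp_le_exp.2 (huv ξ t h0 h1)
  have hM : ∀ ξ t, 0 ≤ t → t < T → M f g ξ t = f ξ t := fun ξ t h0 h1 =>
    min_eq_left (hfg ξ t h0 h1)
  have hlow' : ∀ ξ t, 0 ≤ t → t < T → Real.sqrt c * Real.sqrt (T - t) ≤ f ξ t := by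
    intro ξ t h0 h1
    rw [← Real.sqrt_mul hc.le]
    apply Real.sqrt_le_iff.2
    refine ⟨(W.f_pos ξ t h0 h1).le, ?_⟩
    rw [← hexp ξ t h0 h1]
    exact hlow ξ t h0 h1
  refine ⟨Real.sqrt c, max 2 (6 * K / c), Real.sqrt_pos.2 hc, ?_, ?_⟩
  · intro t h0 h1
    have hl : Real.sqrt c * Real.sqrt (T - t) ≤ Mcheck f g t :=
      le_ciInf fun ξ => by rw [hM ξ t h0 h1]; exact hlow' ξ t h0 h1
    refine ⟨hl, ?_⟩
    have hM0 : 0 ≤ Mcheck f g t := le_trans (by positivity) hl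
    have hbd : BddBelow (range fun ξ => M f g ξ t) := by
      refine ⟨0, ?_⟩
      rintro _ ⟨ξ, rfl⟩
      simp only [hM ξ t h0 h1]
      exact (W.f_pos ξ t h0 h1).le
    have hup := F.upp huv hb t (Mcheck f g t ^ 2) h0 h1 (fun ξ => by
      rw [hexp ξ t h0 h1]
      have : Mcheck f g t ≤ f ξ t := by
        rw [← hM ξ t h0 h1]; exact ciInf_le hbd ξ
      gcongr)
    have h2 : Mcheck f g t ≤ 2 * Real.sqrt (T - t) := by
      refine (pow_le_pow_iff_left₀ hM0 (by positivity) two_ne_zero).1 ?_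
      rw [mul_pow, Real.sq_sqrt (by linarith)]
      linarith
    refine h2.trans ?_
    gcongr
    exact le_max_left _ _
  · intro ξ t h0 h1
    obtain ⟨c1, c2, c3, c4⟩ := hcurv ξ t h0 h1
    have hTt : 0 < T - t := by linarith
    have hlo := hlow ξ t h0 h1
    rw [hexp ξ t h0 h1] at hlo
    rw [← exp_lg W.g_pos h0 h1] at c1 c2 c3 c4
    have hgg : c * (T - t) ≤ g ξ t ^ 2 :=
      hlo.trans (by
        have := hfg ξ t h0 h1
        have := W.f_pos ξ t h0 h1
        gcongr)
    set P := |k01 ρ f ξ t| + 2 * |k02 ρ g ξ t| + 2 * |k12 ρ f g ξ t| + |k23 ρ f g ξ t| with hP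
    have hP0 : 0 ≤ P := by positivity
    have h6 : c * (T - t) * P ≤ 6 * K := by
      refine (mul_le_mul_of_nonneg_right hgg hP0).trans ?_
      rw [hP]; linarith
    rw [le_div_iff₀ hTt]
    refine le_trans ?_ (le_max_right _ _)
    rw [le_div_iff₀ hc]
    linarith

end main
end WB

/-- Under Assumption A the singularity is Type-I:
`c√(T−t) ≤ M̌(t) ≤ C√(T−t)` and all sectional curvatures satisfy
`|κ₀₁| + 2|κ₀₂| + 2|κ₁₂| + |κ₂₃| ≤ C/(T−t)`. -/
theorem type_I_singularity (T : ℝ) (f g ρ : ℝ → ℝ → ℝ)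
    (sol : AssumptionA T f g ρ) :
    ∃ c C : ℝ, 0 < c ∧
      (∀ t : ℝ, 0 ≤ t → t < T →
        c * Real.sqrt (T - t) ≤ Mcheck f g t ∧ Mcheck f g t ≤ C * Real.sqrt (T - t)) ∧
      (∀ ξ t : ℝ, 0 ≤ t → t < T →
        |k01 ρ f ξ t| + 2 * |k02 ρ g ξ t| + 2 * |k12 ρ f g ξ t| + |k23 ρ f g ξ t|
          ≤ C / (T - t)) := by
  exact WB.final sol
end
end

section
/- Let (f,g,ρ) be a warped Berger solution of Ricci flow on S^1×S^3 defined on [0,T) satisfying Assumption B. Then the maximum over ξ of 1/f − 1/g is nonincreasing in t; in particular there exists a uniform constant C < ∞ such that 0 ≤ 1/f(ξ,t) − 1/g(ξ,t) ≤ C, and hence 0 ≤ g(ξ,t) − f(ξ,t) ≤ C·M(ξ,t)², for all (ξ,t) ∈ S^1×[0,T). -/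
open Real Set Filter Topology

noncomputable section

/-- Assumption B: Assumption A and, in addition, at `t = 0` one has `f ≥ (1−ε)g` for some
`ε ∈ (0,1)` with `2(1−ε)⁵ + 4(1−ε)⁴ > 4/3`, and `|f_s| ≤ 1` at `t = 0`. -/
structure AssumptionB (T : ℝ) (f g ρ : ℝ → ℝ → ℝ) extends AssumptionA T f g ρ : Prop where
  init_pinched : ∃ ε : ℝ, 0 < ε ∧ ε < 1 ∧ 2 * (1 - ε) ^ 5 + 4 * (1 - ε) ^ 4 > 4 / 3 ∧
    ∀ ξ : ℝ, (1 - ε) * g ξ 0 ≤ f ξ 0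
  init_fs : ∀ ξ : ℝ, |Ds ρ f ξ 0| ≤ 1

/-- Maximum principle for periodic functions. -/
theorem aux_maxPrinciple (φ : ℝ → ℝ → ℝ) (t₁ t₂ K : ℝ) (h12 : t₁ ≤ t₂)
    (hc : ContinuousOn (fun p : ℝ × ℝ => φ p.1 p.2) (univ ×ˢ Icc t₁ t₂))
    (hper : ∀ x t, φ (x + 2 * π) t = φ x t)
    (hK : ∀ x, φ x t₁ ≤ K)
    (hd : ∀ x t, t₁ < t → t ≤ t₂ → (∀ y, φ y t ≤ φ x t) → K < φ x t →
      ∃ d, HasDerivAt (fun τ => φ x τ) d t ∧ d ≤ 0) :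
    ∀ x, φ x t₂ ≤ K := by
  by_contra hcon
  push Not at hcon
  obtain ⟨x₂, hx₂⟩ := hcon
  have hlt : t₁ < t₂ := by
    rcases h12.lt_or_eq with h | h
    · exact h
    · subst h; exact absurd (hK x₂) (not_le.mpr hx₂)
  have hrep : ∀ y t, ∃ y' ∈ Icc (0 : ℝ) (2 * π), φ y' t = φ y t := by
    intro y t
    have hp : Function.Periodic (fun z => φ z t) (2 * π) := fun z => hper z t
    obtain ⟨y', hy', he⟩ := hp.exists_mem_Ico₀ (by positivity) y
    exact ⟨y', ⟨hy'.1, hy'.2.le⟩, he.symm⟩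
  set δ := (φ x₂ t₂ - K) / (2 * (t₂ - t₁)) with hδ
  have hδpos : 0 < δ := div_pos (by linarith) (by linarith)
  have hδe : δ * (t₂ - t₁) = (φ x₂ t₂ - K) / 2 := by
    rw [hδ]; field_simp [(sub_pos.mpr hlt).ne']
  have hcomp : IsCompact ((Icc (0 : ℝ) (2 * π)) ×ˢ Icc t₁ t₂) := isCompact_Icc.prod isCompact_Icc
  have hcont : ContinuousOn (fun p : ℝ × ℝ => φ p.1 p.2 - δ * (p.2 - t₁))
      ((Icc (0 : ℝ) (2 * π)) ×ˢ Icc t₁ t₂) := by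
    refine ContinuousOn.sub (hc.mono (prod_mono (subset_univ _) subset_rfl)) ?_
    fun_prop
  obtain ⟨⟨x₀, t₀⟩, ⟨hx₀, ht₀⟩, hmax⟩ := hcomp.exists_isMaxOn
    ⟨((0 : ℝ), t₁), ⟨⟨le_refl _, by positivity⟩, ⟨le_refl _, h12⟩⟩⟩ hcont
  simp only at hx₀ ht₀
  have hmax' : ∀ y t, t ∈ Icc t₁ t₂ → φ y t - δ * (t - t₁) ≤ φ x₀ t₀ - δ * (t₀ - t₁) := by
    intro y t ht
    obtain ⟨y', hy', he⟩ := hrep y t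
    have := hmax (show (y', t) ∈ (Icc (0 : ℝ) (2 * π)) ×ˢ Icc t₁ t₂ from ⟨hy', ht⟩)
    simp only [mem_ofPred_eq] at this
    rw [he] at this
    exact this
  have hbig := hmax' x₂ t₂ ⟨h12, le_refl _⟩
  have hnn : 0 ≤ δ * (t₀ - t₁) := mul_nonneg hδpos.le (by linarith [ht₀.1])
  have hgt : K < φ x₀ t₀ := by linarith
  have ht01 : t₁ < t₀ := by
    rcases ht₀.1.lt_or_eq with h | h
    · exact h
    · rw [← h] at hgt; exact absurd (hK x₀) (not_le.mpr hgt)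
  obtain ⟨d, hd1, hd2⟩ := hd x₀ t₀ ht01 ht₀.2
    (fun y => by linarith [hmax' y t₀ ht₀]) hgt
  have hslope := hd1.tendsto_slope
  have hev : ∀ᶠ τ in 𝓝[<] t₀, δ ≤ slope (fun τ => φ x₀ τ) t₀ τ := by
    filter_upwards [Ioo_mem_nhdsLT ht01] with τ hτ
    have := hmax' x₀ τ ⟨hτ.1.le, hτ.2.le.trans ht₀.2⟩
    rw [slope_def_field, le_div_iff_of_neg (by linarith [hτ.2])]
    linarith
  have : δ ≤ d := ge_of_tendsto (hslope.mono_left (nhdsWithin_mono _ (fun τ (hτ : τ ∈ Iio t₀) => ne_of_lt hτ))) hev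
  linarith

/-- Second-order condition at a maximum. -/
theorem aux_secondOrder (φ w ψ : ℝ → ℝ) (x₀ d : ℝ) (hw : ∀ x, 0 < w x)
    (hφ : ∀ x, HasDerivAt φ (w x * ψ x) x) (hm : ∀ y, φ y ≤ φ x₀)
    (hψ : HasDerivAt ψ d x₀) : ψ x₀ = 0 ∧ d ≤ 0 := by
  have h0 : ψ x₀ = 0 := by
    have hl : IsLocalMax φ x₀ := Filter.Eventually.of_forall hm
    have := hl.hasDerivAt_eq_zero (hφ x₀)
    exact (mul_eq_zero.mp this).resolve_left (hw x₀).ne'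
  refine ⟨h0, ?_⟩
  by_contra hd
  push Not at hd
  have hs := hψ.tendsto_slope.mono_left
    (nhdsWithin_mono x₀ (fun τ (hτ : τ ∈ Ioi x₀) => ne_of_gt hτ))
  have hev := hs.eventually (lt_mem_nhds hd)
  obtain ⟨u, hu, hu2⟩ := mem_nhdsGT_iff_exists_Ioo_subset.mp hev
  have hpos : ∀ x ∈ Ioo x₀ u, 0 < ψ x := by
    intro x hx
    have := hu2 hx
    simp only [mem_ofPred_eq, slope_def_field, h0, sub_zero] at this
    exact (div_pos_iff_of_pos_right (by linarith [hx.1])).mp this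
  have hmono : StrictMonoOn φ (Icc x₀ ((x₀ + u) / 2)) := by
    have hu' : x₀ < u := hu
    refine strictMonoOn_of_deriv_pos (convex_Icc _ _)
      (fun x _ => (hφ x).continuousAt.continuousWithinAt) ?_
    intro x hx
    rw [interior_Icc] at hx
    rw [(hφ x).deriv]
    exact mul_pos (hw x) (hpos x ⟨hx.1, by linarith [hx.2]⟩)
  have hu' : x₀ < u := hu
  have := hmono (left_mem_Icc.mpr (by linarith)) (right_mem_Icc.mpr (by linarith))
    (show x₀ < (x₀ + u) / 2 by linarith)
  linarith [hm ((x₀ + u) / 2)]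

/-- Smoothness of a function of two variables on `ℝ × [0,T)`. -/
def Sm (T : ℝ) (φ : ℝ → ℝ → ℝ) : Prop :=
  ContDiffOn ℝ (⊤ : ℕ∞) (fun p : ℝ × ℝ => φ p.1 p.2) (Set.univ ×ˢ Set.Ico 0 T)

theorem Sm.uniq (T : ℝ) : UniqueDiffOn ℝ ((Set.univ : Set ℝ) ×ˢ Set.Ico (0 : ℝ) T) :=
  uniqueDiffOn_univ.prod (uniqueDiffOn_Ico 0 T)

theorem Sm.hasFD {T : ℝ} {φ : ℝ → ℝ → ℝ} (h : Sm T φ) {x t : ℝ} (h0 : 0 ≤ t) (h1 : t < T) :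
    HasDerivAt (fun y => φ y t)
      (fderivWithin ℝ (fun p : ℝ × ℝ => φ p.1 p.2) (Set.univ ×ˢ Set.Ico 0 T) (x, t) (1, 0)) x := by
  have hF := ((h.differentiableOn (by simp)) (x, t) ⟨trivial, h0, h1⟩).hasFDerivWithinAt
  have hi : HasDerivWithinAt (fun y : ℝ => (y, t)) ((1 : ℝ), (0 : ℝ)) univ x :=
    ((hasDerivAt_id x).prodMk (hasDerivAt_const x t)).hasDerivWithinAt
  have hmt : MapsTo (fun y : ℝ => (y, t)) univ (Set.univ ×ˢ Set.Ico 0 T) :=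
    fun y _ => ⟨trivial, h0, h1⟩
  have := hF.comp_hasDerivWithinAt x hi hmt
  exact hasDerivWithinAt_univ.mp this

theorem Sm.dx {T : ℝ} {φ : ℝ → ℝ → ℝ} (h : Sm T φ) {x t : ℝ} (h0 : 0 ≤ t) (h1 : t < T) :
    HasDerivAt (fun y => φ y t) (pd1 φ x t) x :=
  (h.hasFD h0 h1).differentiableAt.hasDerivAt

theorem Sm.pd1 {T : ℝ} {φ : ℝ → ℝ → ℝ} (h : Sm T φ) : Sm T (pd1 φ) := by
  have h1 : ContDiffOn ℝ (⊤ : ℕ∞)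
      (fderivWithin ℝ (fun p : ℝ × ℝ => φ p.1 p.2) (Set.univ ×ˢ Set.Ico 0 T))
      (Set.univ ×ˢ Set.Ico 0 T) := ContDiffOn.fderivWithin h (Sm.uniq T) (by simp)
  have h2 := h1.clm_apply (contDiffOn_const (c := ((1 : ℝ), (0 : ℝ))))
  exact h2.congr (fun p hp => (h.hasFD hp.2.1 hp.2.2).deriv)

theorem Sm.Ds {T : ℝ} {φ ρ : ℝ → ℝ → ℝ} (h : Sm T φ) (hρ : Sm T ρ)
    (hp : ∀ ξ t : ℝ, 0 ≤ t → t < T → 0 < ρ ξ t) : Sm T (Ds ρ φ) :=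
  ContDiffOn.div h.pd1 hρ (fun p hq => (hp p.1 p.2 hq.2.1 hq.2.2).ne')

theorem Sm.cda {T : ℝ} {φ : ℝ → ℝ → ℝ} (h : Sm T φ) {x t : ℝ} (h0 : 0 < t) (h1 : t < T) :
    ContDiffAt ℝ (⊤ : ℕ∞) (fun p : ℝ × ℝ => φ p.1 p.2) (x, t) :=
  h.contDiffAt (prod_mem_nhds univ_mem (Ico_mem_nhds h0 h1))

theorem Sm.dt {T : ℝ} {φ : ℝ → ℝ → ℝ} (h : Sm T φ) {x t : ℝ} (h0 : 0 < t) (h1 : t < T) :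
    HasDerivAt (fun τ => φ x τ) (pdt φ x t) t := by
  have hF := ((h.cda (x := x) h0 h1).differentiableAt (by simp)).hasFDerivAt
  have hi : HasDerivAt (fun τ : ℝ => (x, τ)) ((0 : ℝ), (1 : ℝ)) t :=
    (hasDerivAt_const t x).prodMk (hasDerivAt_id t)
  exact (hF.comp_hasDerivAt t hi).differentiableAt.hasDerivAt

theorem Sm.pdt_eq {T : ℝ} {φ : ℝ → ℝ → ℝ} (h : Sm T φ) {x t : ℝ} (h0 : 0 < t) (h1 : t < T) :
    pdt φ x t = fderiv ℝ (fun p : ℝ × ℝ => φ p.1 p.2) (x, t) (0, 1) := by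
  have hF := ((h.cda (x := x) h0 h1).differentiableAt (by simp)).hasFDerivAt
  have hi : HasDerivAt (fun τ : ℝ => (x, τ)) ((0 : ℝ), (1 : ℝ)) t :=
    (hasDerivAt_const t x).prodMk (hasDerivAt_id t)
  exact (hF.comp_hasDerivAt t hi).deriv

theorem Sm.pd1_eq {T : ℝ} {φ : ℝ → ℝ → ℝ} (h : Sm T φ) {x t : ℝ} (h0 : 0 < t) (h1 : t < T) :
    _root_.pd1 φ x t = fderiv ℝ (fun p : ℝ × ℝ => φ p.1 p.2) (x, t) (1, 0) := by
  have hF := ((h.cda (x := x) h0 h1).differentiableAt (by simp)).hasFDerivAt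
  have hi : HasDerivAt (fun τ : ℝ => (τ, t)) ((1 : ℝ), (0 : ℝ)) x :=
    (hasDerivAt_id x).prodMk (hasDerivAt_const x t)
  exact (hF.comp_hasDerivAt x hi).deriv

theorem Sm.comm {T : ℝ} {φ : ℝ → ℝ → ℝ} (h : Sm T φ) {x t : ℝ} (h0 : 0 < t) (h1 : t < T) :
    pdt (_root_.pd1 φ) x t = _root_.pd1 (pdt φ) x t := by
  have hc := h.cda (x := x) h0 h1
  have hsym := hc.isSymmSndFDerivAt (by simp; norm_cast)
  have hD : DifferentiableAt ℝ (fderiv ℝ (fun p : ℝ × ℝ => φ p.1 p.2)) (x, t) :=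
    (hc.fderiv_right (m := 1) (by norm_cast)).differentiableAt (by simp)
  have e1 : (fun τ => _root_.pd1 φ x τ) =ᶠ[𝓝 t]
      fun τ => fderiv ℝ (fun p : ℝ × ℝ => φ p.1 p.2) (x, τ) (1, 0) := by
    filter_upwards [Ioo_mem_nhds h0 h1] with τ hτ using h.pd1_eq hτ.1 hτ.2
  have e2 : (fun y => pdt φ y t) =
      fun y => fderiv ℝ (fun p : ℝ × ℝ => φ p.1 p.2) (y, t) (0, 1) := by
    funext y; exact h.pdt_eq h0 h1
  have hi : HasDerivAt (fun τ : ℝ => (x, τ)) ((0 : ℝ), (1 : ℝ)) t :=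
    (hasDerivAt_const t x).prodMk (hasDerivAt_id t)
  have hj : HasDerivAt (fun τ : ℝ => (τ, t)) ((1 : ℝ), (0 : ℝ)) x :=
    (hasDerivAt_id x).prodMk (hasDerivAt_const x t)
  have d1 : HasDerivAt (fun τ => fderiv ℝ (fun p : ℝ × ℝ => φ p.1 p.2) (x, τ) (1, 0))
      (fderiv ℝ (fderiv ℝ (fun p : ℝ × ℝ => φ p.1 p.2)) (x, t) (0, 1) (1, 0)) t := by
    have q := HasFDerivAt.comp_hasDerivAt t (f := fun τ : ℝ => (x, τ)) hD.hasFDerivAt hi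
    have := q.clm_apply (hasDerivAt_const t ((1 : ℝ), (0 : ℝ)))
    simp only [map_zero, add_zero, Function.comp] at this
    exact this
  have d2 : HasDerivAt (fun y => fderiv ℝ (fun p : ℝ × ℝ => φ p.1 p.2) (y, t) (0, 1))
      (fderiv ℝ (fderiv ℝ (fun p : ℝ × ℝ => φ p.1 p.2)) (x, t) (1, 0) (0, 1)) x := by
    have q := HasFDerivAt.comp_hasDerivAt x (f := fun τ : ℝ => (τ, t)) hD.hasFDerivAt hj
    have := q.clm_apply (hasDerivAt_const x ((0 : ℝ), (1 : ℝ)))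
    simp only [map_zero, add_zero, Function.comp] at this
    exact this
  have a1 : pdt (_root_.pd1 φ) x t = _ := e1.deriv_eq.trans d1.deriv
  have a2 : _root_.pd1 (pdt φ) x t = _ := (congrArg (fun F => deriv F x) e2).trans d2.deriv
  rw [a1, a2]
  exact hsym _ _

theorem Sm.ds {T : ℝ} {φ ρ : ℝ → ℝ → ℝ} (h : Sm T φ)
    (hp : ∀ ξ t : ℝ, 0 ≤ t → t < T → 0 < ρ ξ t) {x t : ℝ} (h0 : 0 ≤ t) (h1 : t < T) :
    HasDerivAt (fun y => φ y t) (ρ x t * _root_.Ds ρ φ x t) x := by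
  have := h.dx (x := x) h0 h1
  have e : ρ x t * _root_.Ds ρ φ x t = _root_.pd1 φ x t := by
    unfold _root_.Ds
    field_simp [(hp x t h0 h1).ne']
  rw [e]; exact this

theorem WarpedBerger.smf {T : ℝ} {f g ρ : ℝ → ℝ → ℝ} (W : WarpedBerger T f g ρ) : Sm T f :=
  W.smooth.fst

theorem WarpedBerger.smg {T : ℝ} {f g ρ : ℝ → ℝ → ℝ} (W : WarpedBerger T f g ρ) : Sm T g :=
  W.smooth.snd.fst

theorem WarpedBerger.smr {T : ℝ} {f g ρ : ℝ → ℝ → ℝ} (W : WarpedBerger T f g ρ) : Sm T ρ :=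
  W.smooth.snd.snd

theorem pd1_per {φ : ℝ → ℝ → ℝ} (h : ∀ ξ t : ℝ, φ (ξ + 2 * π) t = φ ξ t) (ξ t : ℝ) :
    pd1 φ (ξ + 2 * π) t = pd1 φ ξ t := by
  unfold pd1
  rw [← deriv_comp_add_const (fun x => φ x t) (2 * π) ξ]
  simp only [h]

theorem alg_quot (f g fs gs fss gss : ℝ) (hg : 0 < g) (hf : 0 < f) :
    (fss + 2 * (gs / g) * fs - 2 * f ^ 3 / g ^ 4) * g
      - f * (gss + (fs / f + gs / g) * gs + 2 * (f ^ 2 - 2 * g ^ 2) / g ^ 3)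
    = (g * fss - f * gss) + gs * (fs * g - f * gs) / g + 4 * f * (g ^ 2 - f ^ 2) / g ^ 3 := by
  field_simp
  ring

theorem f_le_g {T : ℝ} {f g ρ : ℝ → ℝ → ℝ} (W : WarpedBerger T f g ρ)
    (hi : ∀ ξ, f ξ 0 ≤ g ξ 0) (ξ t : ℝ) (h0 : 0 ≤ t) (h1 : t < T) : f ξ t ≤ g ξ t := by
  have hS : (univ : Set ℝ) ×ˢ Icc 0 t ⊆ univ ×ˢ Ico 0 T :=
    prod_mono subset_rfl (fun τ hτ => ⟨hτ.1, hτ.2.trans_lt h1⟩)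
  have key := aux_maxPrinciple (fun x τ => f x τ / g x τ) 0 t 1 h0
    ((ContDiffOn.continuousOn W.smf).mono hS |>.div ((ContDiffOn.continuousOn W.smg).mono hS)
      (fun p hp => (W.g_pos _ _ (hS hp).2.1 (hS hp).2.2).ne'))
    (fun x τ => by simp only [W.f_per, W.g_per])
    (fun x => (div_le_one (W.g_pos x 0 le_rfl W.T_pos)).mpr (hi x)) ?_ ξ
  · exact (div_le_one (W.g_pos ξ t h0 h1)).mp key
  intro x τ hτ0 hτ1 hm hK
  have hτT : τ < T := hτ1.trans_lt h1
  have hg := fun y => W.g_pos y τ hτ0.le hτT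
  have hf := fun y => W.f_pos y τ hτ0.le hτT
  have hr := fun y => W.ρ_pos y τ hτ0.le hτT
  have df := fun y => W.smf.ds W.ρ_pos (x := y) hτ0.le hτT
  have dg := fun y => W.smg.ds W.ρ_pos (x := y) hτ0.le hτT
  have dfs := (W.smf.Ds W.smr W.ρ_pos).ds W.ρ_pos (x := x) hτ0.le hτT
  have dgs := (W.smg.Ds W.smr W.ρ_pos).ds W.ρ_pos (x := x) hτ0.le hτT
  have so := aux_secondOrder (fun y => f y τ / g y τ) (fun y => ρ y τ / g y τ ^ 2)
    (fun y => Ds ρ f y τ * g y τ - f y τ * Ds ρ g y τ) x _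
    (fun y => div_pos (hr y) (pow_pos (hg y) 2))
    (fun y => ((df y).fun_div (dg y) (hg y).ne').congr_deriv (by ring)) hm
    ((dfs.fun_mul (dg x)).fun_sub ((df x).fun_mul dgs))
  obtain ⟨so1, so2⟩ := so
  refine ⟨_, (W.smf.dt hτ0 hτT).fun_div (W.smg.dt hτ0 hτT) (hg x).ne', ?_⟩
  refine div_nonpos_of_nonpos_of_nonneg ?_ (by positivity)
  rw [W.eq_f x τ hτ0 hτT, W.eq_g x τ hτ0 hτT, alg_quot _ _ _ _ _ _ (hg x) (hf x)]
  rw [so1]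
  have h2 : g x τ * Ds ρ (Ds ρ f) x τ - f x τ * Ds ρ (Ds ρ g) x τ ≤ 0 := by
    refine nonpos_of_mul_nonpos_right (a := ρ x τ) ?_ (hr x)
    linarith
  have h3 : g x τ < f x τ := (one_lt_div (hg x)).mp hK
  have h4 : 4 * f x τ * (g x τ ^ 2 - f x τ ^ 2) / g x τ ^ 3 ≤ 0 := by
    refine div_nonpos_of_nonpos_of_nonneg ?_ (pow_pos (hg x) 3).le
    have := hf x
    have := hg x
    refine mul_nonpos_of_nonneg_of_nonpos (by linarith) (by nlinarith)
  simp only [mul_zero, zero_div, add_zero]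
  linarith

theorem f_pinched {T : ℝ} {f g ρ : ℝ → ℝ → ℝ} (W : WarpedBerger T f g ρ) (c : ℝ) (hc : c < 1)
    (hi : ∀ ξ, c * g ξ 0 ≤ f ξ 0) (ξ t : ℝ) (h0 : 0 ≤ t) (h1 : t < T) :
    c * g ξ t ≤ f ξ t := by
  have hS : (univ : Set ℝ) ×ˢ Icc 0 t ⊆ univ ×ˢ Ico 0 T :=
    prod_mono subset_rfl (fun τ hτ => ⟨hτ.1, hτ.2.trans_lt h1⟩)
  have key := aux_maxPrinciple (fun x τ => -(f x τ / g x τ)) 0 t (-c) h0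
    (((ContDiffOn.continuousOn W.smf).mono hS |>.div ((ContDiffOn.continuousOn W.smg).mono hS)
      (fun p hp => (W.g_pos _ _ (hS hp).2.1 (hS hp).2.2).ne')).neg)
    (fun x τ => by simp only [W.f_per, W.g_per])
    (fun x => neg_le_neg ((le_div_iff₀ (W.g_pos x 0 le_rfl W.T_pos)).mpr (hi x))) ?_ ξ
  · exact (le_div_iff₀ (W.g_pos ξ t h0 h1)).mp (neg_le_neg_iff.mp key)
  intro x τ hτ0 hτ1 hm hK
  have hτT : τ < T := hτ1.trans_lt h1
  have hg := fun y => W.g_pos y τ hτ0.le hτT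
  have hf := fun y => W.f_pos y τ hτ0.le hτT
  have hr := fun y => W.ρ_pos y τ hτ0.le hτT
  have df := fun y => W.smf.ds W.ρ_pos (x := y) hτ0.le hτT
  have dg := fun y => W.smg.ds W.ρ_pos (x := y) hτ0.le hτT
  have dfs := (W.smf.Ds W.smr W.ρ_pos).ds W.ρ_pos (x := x) hτ0.le hτT
  have dgs := (W.smg.Ds W.smr W.ρ_pos).ds W.ρ_pos (x := x) hτ0.le hτT
  have so := aux_secondOrder (fun y => -(f y τ / g y τ)) (fun y => ρ y τ / g y τ ^ 2)
    (fun y => f y τ * Ds ρ g y τ - Ds ρ f y τ * g y τ) x _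
    (fun y => div_pos (hr y) (pow_pos (hg y) 2))
    (fun y => ((df y).fun_div (dg y) (hg y).ne').fun_neg.congr_deriv (by ring)) hm
    (((df x).fun_mul dgs).fun_sub (dfs.fun_mul (dg x)))
  obtain ⟨so1, so2⟩ := so
  refine ⟨_, ((W.smf.dt hτ0 hτT).fun_div (W.smg.dt hτ0 hτT) (hg x).ne').fun_neg, ?_⟩
  refine neg_nonpos.mpr (div_nonneg ?_ (by positivity))
  rw [W.eq_f x τ hτ0 hτT, W.eq_g x τ hτ0 hτT, alg_quot _ _ _ _ _ _ (hg x) (hf x)]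
  have so1' : Ds ρ f x τ * g x τ - f x τ * Ds ρ g x τ = 0 := by linarith
  rw [so1']
  have h2 : f x τ * Ds ρ (Ds ρ g) x τ - g x τ * Ds ρ (Ds ρ f) x τ ≤ 0 := by
    refine nonpos_of_mul_nonpos_right (a := ρ x τ) ?_ (hr x)
    linarith
  have h3 : f x τ < g x τ := by
    have : f x τ / g x τ < 1 := (neg_lt_neg_iff.mp hK).trans hc
    exact (div_lt_one (hg x)).mp this
  have h4 : 0 ≤ 4 * f x τ * (g x τ ^ 2 - f x τ ^ 2) / g x τ ^ 3 := by
    refine div_nonneg ?_ (pow_pos (hg x) 3).le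
    have := hf x
    have := hg x
    refine mul_nonneg (by linarith) (by nlinarith)
  simp only [mul_zero, zero_div, add_zero]
  linarith

theorem fs_evol {T : ℝ} {f g ρ : ℝ → ℝ → ℝ} (W : WarpedBerger T f g ρ)
    (x t : ℝ) (h0 : 0 < t) (h1 : t < T) :
    pdt (Ds ρ f) x t = Ds ρ (Ds ρ (Ds ρ f)) x t
      + (2 * Ds ρ g x t / g x t - Ds ρ f x t / f x t) * Ds ρ (Ds ρ f) x t
      - (2 * Ds ρ g x t ^ 2 / g x t ^ 2 + 6 * f x t ^ 2 / g x t ^ 4) * Ds ρ f x t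
      + 8 * f x t ^ 3 * Ds ρ g x t / g x t ^ 5 := by
  have hg := W.g_pos x t h0.le h1
  have hf := W.f_pos x t h0.le h1
  have hr := W.ρ_pos x t h0.le h1
  have sfs := W.smf.Ds W.smr W.ρ_pos
  have sgs := W.smg.Ds W.smr W.ρ_pos
  have df := W.smf.ds W.ρ_pos (x := x) h0.le h1
  have dg := W.smg.ds W.ρ_pos (x := x) h0.le h1
  have dfs := sfs.ds W.ρ_pos (x := x) h0.le h1
  have dgs := sgs.ds W.ρ_pos (x := x) h0.le h1
  have dfss := (sfs.Ds W.smr W.ρ_pos).ds W.ρ_pos (x := x) h0.le h1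
  -- time derivative of the quotient
  have hq : pdt (Ds ρ f) x t = _ :=
    ((W.smf.pd1.dt (x := x) h0 h1).fun_div (W.smr.dt (x := x) h0 h1) hr.ne').deriv
  have hl : pdt (fun x τ => Real.log (ρ x τ)) x t = _ :=
    ((W.smr.dt (x := x) h0 h1).log hr.ne').deriv
  rw [W.eq_ρ x t h0 h1] at hl
  have hl' : pdt ρ x t = ρ x t *
      (Ds ρ (Ds ρ f) x t / f x t + 2 * (Ds ρ (Ds ρ g) x t / g x t)) := by
    rw [hl]; field_simp
  have hfun : (fun y => pdt f y t) = fun y => Ds ρ (Ds ρ f) y t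
      + 2 * (Ds ρ g y t / g y t) * Ds ρ f y t - 2 * (f y t) ^ 3 / (g y t) ^ 4 := by
    funext y; exact W.eq_f y t h0 h1
  have hx : pd1 (pdt f) x t = _ := (congrArg (fun F => deriv F x) hfun).trans
    ((dfss.fun_add (((dgs.fun_div dg hg.ne').const_mul 2).fun_mul dfs)).fun_sub
      (((df.fun_pow 3).const_mul 2).fun_div (dg.fun_pow 4) (pow_pos hg 4).ne')).deriv
  have hp : pd1 f x t = ρ x t * Ds ρ f x t := by
    unfold Ds; field_simp
  rw [hq, W.smf.comm h0 h1, hx, hl', hp]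
  field_simp
  push_cast
  ring

theorem alg_fs (f g X X2 gs : ℝ) (hf : 0 < f) (hg : 0 < g) (hfg : f ≤ g) (hX : 4 / 3 < X ^ 2)
    (h2 : X * X2 ≤ 0) :
    X * (X2 - (2 * gs ^ 2 / g ^ 2 + 6 * f ^ 2 / g ^ 4) * X + 8 * f ^ 3 * gs / g ^ 5) ≤ 0 := by
  have e : X * (X2 - (2 * gs ^ 2 / g ^ 2 + 6 * f ^ 2 / g ^ 4) * X + 8 * f ^ 3 * gs / g ^ 5)
      = X * X2 - 2 * (gs / g * X - 2 * f ^ 3 / g ^ 4) ^ 2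
        - 6 * (f ^ 2 / g ^ 4) * (X ^ 2 - 4 / 3 * (f / g) ^ 4) := by
    field_simp; ring
  rw [e]
  have h1 : (f / g) ^ 4 ≤ 1 := pow_le_one₀ (by positivity) ((div_le_one hg).mpr hfg)
  have h3 : 0 ≤ 6 * (f ^ 2 / g ^ 4) * (X ^ 2 - 4 / 3 * (f / g) ^ 4) :=
    mul_nonneg (by positivity) (by linarith)
  nlinarith [sq_nonneg (gs / g * X - 2 * f ^ 3 / g ^ 4)]

theorem fs_bound {T : ℝ} {f g ρ : ℝ → ℝ → ℝ} (W : WarpedBerger T f g ρ)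
    (hi : ∀ ξ, f ξ 0 ≤ g ξ 0) (hfs : ∀ ξ, |Ds ρ f ξ 0| ≤ 1)
    (ξ t : ℝ) (h0 : 0 ≤ t) (h1 : t < T) : Ds ρ f ξ t ^ 2 ≤ 4 / 3 := by
  have hS : (univ : Set ℝ) ×ˢ Icc 0 t ⊆ univ ×ˢ Ico 0 T :=
    prod_mono subset_rfl (fun τ hτ => ⟨hτ.1, hτ.2.trans_lt h1⟩)
  have sfs := W.smf.Ds W.smr W.ρ_pos
  refine aux_maxPrinciple (fun x τ => Ds ρ f x τ ^ 2) 0 t (4 / 3) h0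
    (((ContDiffOn.continuousOn sfs).mono hS).pow 2)
    (fun x τ => by simp only [Ds, pd1_per W.f_per, W.ρ_per])
    (fun x => by
      have := (sq_le_one_iff_abs_le_one _).mpr (hfs x)
      linarith) ?_ ξ
  intro x τ hτ0 hτ1 hm hK
  have hτT : τ < T := hτ1.trans_lt h1
  have hg := W.g_pos x τ hτ0.le hτT
  have hf := W.f_pos x τ hτ0.le hτT
  have hr := fun y => W.ρ_pos y τ hτ0.le hτT
  have dfs := fun y => sfs.ds W.ρ_pos (x := y) hτ0.le hτT
  have dfss := (sfs.Ds W.smr W.ρ_pos).ds W.ρ_pos (x := x) hτ0.le hτT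
  have so := aux_secondOrder (fun y => Ds ρ f y τ ^ 2) (fun y => 2 * ρ y τ)
    (fun y => Ds ρ f y τ * Ds ρ (Ds ρ f) y τ) x _
    (fun y => mul_pos two_pos (hr y))
    (fun y => ((dfs y).fun_pow 2).congr_deriv (by push_cast; ring)) hm
    ((dfs x).fun_mul dfss)
  obtain ⟨so1, so2⟩ := so
  have hX : Ds ρ f x τ ≠ 0 := by
    intro h; rw [h] at hK; norm_num at hK
  have hX1 : Ds ρ (Ds ρ f) x τ = 0 := (mul_eq_zero.mp so1).resolve_left hX
  rw [hX1] at so2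
  have h2 : Ds ρ f x τ * Ds ρ (Ds ρ (Ds ρ f)) x τ ≤ 0 := by
    refine nonpos_of_mul_nonpos_right (a := ρ x τ) ?_ (hr x)
    linarith
  refine ⟨_, (sfs.dt hτ0 hτT).fun_pow 2, ?_⟩
  rw [fs_evol W x τ hτ0 hτT, hX1]
  have := alg_fs (f x τ) (g x τ) _ _ (Ds ρ g x τ) hf hg (f_le_g W hi x τ hτ0.le hτT) hK h2
  push_cast
  simp only [mul_zero, add_zero]
  nlinarith

theorem alg_h (f g fs gs fss gss c : ℝ) (hf : 0 < f) (hg : 0 < g) (hfg : f ≤ g)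
    (hc : 0 < c) (hc2 : 2 * c ^ 5 + 4 * c ^ 4 > 4 / 3) (hcg : c * g ≤ f) (hfs : fs ^ 2 ≤ 4 / 3)
    (hcrit : gs / g ^ 2 - fs / f ^ 2 = 0)
    (h2 : gss / g ^ 2 - 2 * gs ^ 2 / g ^ 3 - fss / f ^ 2 + 2 * fs ^ 2 / f ^ 3 ≤ 0) :
    -(fss + 2 * (gs / g) * fs - 2 * f ^ 3 / g ^ 4) / f ^ 2
      + (gss + (fs / f + gs / g) * gs + 2 * (f ^ 2 - 2 * g ^ 2) / g ^ 3) / g ^ 2 ≤ 0 := by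
  obtain ⟨p, hp⟩ : ∃ p, fs / f ^ 2 = p := ⟨_, rfl⟩
  have hgp : gs / g ^ 2 = p := by linarith
  have hfs' : fs = p * f ^ 2 := by rw [← hp]; field_simp
  have hgs' : gs = p * g ^ 2 := by rw [← hgp]; field_simp
  subst hfs' hgs'
  have e : -(fss + 2 * (p * g ^ 2 / g) * (p * f ^ 2) - 2 * f ^ 3 / g ^ 4) / f ^ 2
      + (gss + (p * f ^ 2 / f + p * g ^ 2 / g) * (p * g ^ 2)
        + 2 * (f ^ 2 - 2 * g ^ 2) / g ^ 3) / g ^ 2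
      = (gss / g ^ 2 - 2 * (p * g ^ 2) ^ 2 / g ^ 3 - fss / f ^ 2 + 2 * (p * f ^ 2) ^ 2 / f ^ 3)
        - (g - f) / f ^ 4 * ((2 * (f / g) ^ 5 + 4 * (f / g) ^ 4) - (p * f ^ 2) ^ 2) := by
    field_simp; ring
  rw [e]
  have hr : c ≤ f / g := (le_div_iff₀ hg).mpr hcg
  have h5 : c ^ 5 ≤ (f / g) ^ 5 := pow_le_pow_left₀ hc.le hr 5
  have h4 : c ^ 4 ≤ (f / g) ^ 4 := pow_le_pow_left₀ hc.le hr 4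
  have h6 : 0 ≤ (g - f) / f ^ 4 * ((2 * (f / g) ^ 5 + 4 * (f / g) ^ 4) - (p * f ^ 2) ^ 2) :=
    mul_nonneg (div_nonneg (by linarith) (by positivity)) (by linarith)
  linarith

theorem h_bound {T : ℝ} {f g ρ : ℝ → ℝ → ℝ} (sol : AssumptionB T f g ρ) (K t₁ t₂ : ℝ)
    (h0 : 0 ≤ t₁) (h12 : t₁ ≤ t₂) (h1 : t₂ < T)
    (hK : ∀ x, 1 / f x t₁ - 1 / g x t₁ ≤ K) (ξ : ℝ) : 1 / f ξ t₂ - 1 / g ξ t₂ ≤ K := by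
  have W := sol.toWarpedBerger
  obtain ⟨ε, hε0, hε1, hε2, hε3⟩ := sol.init_pinched
  have hS : (univ : Set ℝ) ×ˢ Icc t₁ t₂ ⊆ univ ×ˢ Ico 0 T :=
    prod_mono subset_rfl (fun τ hτ => ⟨h0.trans hτ.1, hτ.2.trans_lt h1⟩)
  refine aux_maxPrinciple (fun x τ => 1 / f x τ - 1 / g x τ) t₁ t₂ K h12
    ((continuousOn_const.div ((ContDiffOn.continuousOn W.smf).mono hS)
      (fun p hp => (W.f_pos _ _ (hS hp).2.1 (hS hp).2.2).ne')).sub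
      (continuousOn_const.div ((ContDiffOn.continuousOn W.smg).mono hS)
      (fun p hp => (W.g_pos _ _ (hS hp).2.1 (hS hp).2.2).ne')))
    (fun x τ => by simp only [W.f_per, W.g_per]) hK ?_ ξ
  intro x τ hτ0' hτ1 hm _
  have hτ0 : 0 < τ := h0.trans_lt hτ0'
  have hτT : τ < T := hτ1.trans_lt h1
  have hg := fun y => W.g_pos y τ hτ0.le hτT
  have hf := fun y => W.f_pos y τ hτ0.le hτT
  have hr := fun y => W.ρ_pos y τ hτ0.le hτT
  have df := fun y => W.smf.ds W.ρ_pos (x := y) hτ0.le hτT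
  have dg := fun y => W.smg.ds W.ρ_pos (x := y) hτ0.le hτT
  have dfs := (W.smf.Ds W.smr W.ρ_pos).ds W.ρ_pos (x := x) hτ0.le hτT
  have dgs := (W.smg.Ds W.smr W.ρ_pos).ds W.ρ_pos (x := x) hτ0.le hτT
  have so := aux_secondOrder (fun y => 1 / f y τ - 1 / g y τ) (fun y => ρ y τ)
    (fun y => Ds ρ g y τ / g y τ ^ 2 - Ds ρ f y τ / f y τ ^ 2) x _ hr
    (fun y => (((hasDerivAt_const y (1 : ℝ)).fun_div (df y) (hf y).ne').fun_sub
      ((hasDerivAt_const y (1 : ℝ)).fun_div (dg y) (hg y).ne')).congr_deriv (by ring)) hm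
    ((dgs.fun_div ((dg x).fun_pow 2) (pow_pos (hg x) 2).ne').fun_sub
      (dfs.fun_div ((df x).fun_pow 2) (pow_pos (hf x) 2).ne'))
  obtain ⟨so1, so2⟩ := so
  have hfx := hf x
  have hgx := hg x
  refine ⟨_, (((hasDerivAt_const τ (1 : ℝ)).fun_div (W.smf.dt hτ0 hτT) (hf x).ne').fun_sub
      ((hasDerivAt_const τ (1 : ℝ)).fun_div (W.smg.dt hτ0 hτT) (hg x).ne')), ?_⟩
  have := alg_h (f x τ) (g x τ) (Ds ρ f x τ) (Ds ρ g x τ) (Ds ρ (Ds ρ f) x τ)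
    (Ds ρ (Ds ρ g) x τ) (1 - ε) hfx hgx (f_le_g W sol.init_order x τ hτ0.le hτT)
    (by linarith) hε2 (f_pinched W (1 - ε) (by linarith) hε3 x τ hτ0.le hτT)
    (fs_bound W sol.init_order sol.init_fs x τ hτ0.le hτT) so1 (by
      refine nonpos_of_mul_nonpos_right (a := ρ x τ) ?_ (hr x)
      refine le_trans (le_of_eq ?_) so2
      push_cast
      field_simp
      ring)
  rw [← W.eq_f x τ hτ0 hτT, ← W.eq_g x τ hτ0 hτT] at this
  refine le_trans (le_of_eq ?_) this
  ring

theorem h_bdd {T : ℝ} {f g ρ : ℝ → ℝ → ℝ} (W : WarpedBerger T f g ρ) (t : ℝ)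
    (h0 : 0 ≤ t) (h1 : t < T) : BddAbove (range fun ξ => 1 / f ξ t - 1 / g ξ t) := by
  have hc : Continuous (fun ξ => 1 / f ξ t - 1 / g ξ t) := by
    have c1 : Continuous fun ξ => f ξ t :=
      continuous_iff_continuousAt.mpr fun x => (W.smf.dx h0 h1).continuousAt
    have c2 : Continuous fun ξ => g ξ t :=
      continuous_iff_continuousAt.mpr fun x => (W.smg.dx h0 h1).continuousAt
    exact (continuous_const.div c1 fun x => (W.f_pos x t h0 h1).ne').sub
      (continuous_const.div c2 fun x => (W.g_pos x t h0 h1).ne')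
  obtain ⟨B, hB⟩ := (isCompact_Icc (a := (0 : ℝ)) (b := 2 * π)).bddAbove_image hc.continuousOn
  refine ⟨B, ?_⟩
  rintro _ ⟨y, rfl⟩
  have hp : Function.Periodic (fun ξ => 1 / f ξ t - 1 / g ξ t) (2 * π) :=
    fun z => by simp only [W.f_per, W.g_per]
  obtain ⟨y', hy', he⟩ := hp.exists_mem_Ico₀ (by positivity) y
  simp only at he ⊢
  rw [he]
  exact hB ⟨y', ⟨hy'.1, hy'.2.le⟩, rfl⟩

/-- Under Assumption B, `max_ξ (1/f − 1/g)` is nonincreasing in time;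
in particular there is a uniform constant `C` with `0 ≤ 1/f − 1/g ≤ C`, and hence
`0 ≤ g − f ≤ C·M²`, for as long as the solution exists. -/
theorem sharper_C0_estimate (T : ℝ) (f g ρ : ℝ → ℝ → ℝ)
    (sol : AssumptionB T f g ρ) :
    (∀ t₁ t₂ : ℝ, 0 ≤ t₁ → t₁ ≤ t₂ → t₂ < T →
      (⨆ ξ : ℝ, (1 / f ξ t₂ - 1 / g ξ t₂)) ≤ ⨆ ξ : ℝ, (1 / f ξ t₁ - 1 / g ξ t₁)) ∧
    ∃ C : ℝ, ∀ ξ t : ℝ, 0 ≤ t → t < T →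
      0 ≤ 1 / f ξ t - 1 / g ξ t ∧ 1 / f ξ t - 1 / g ξ t ≤ C ∧
      0 ≤ g ξ t - f ξ t ∧ g ξ t - f ξ t ≤ C * (M f g ξ t) ^ 2 := by
  have W := sol.toWarpedBerger
  refine ⟨fun t₁ t₂ h0 h12 h1 => ciSup_le fun ξ => h_bound sol _ t₁ t₂ h0 h12 h1
    (fun x => le_ciSup (h_bdd W t₁ h0 (h12.trans_lt h1)) x) ξ, ?_⟩
  obtain ⟨ε, hε0, hε1, hε2, hε3⟩ := sol.init_pinched
  obtain ⟨B, hB⟩ := h_bdd W 0 le_rfl W.T_pos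
  have hc : 0 < 1 - ε := by linarith
  refine ⟨B / (1 - ε), fun ξ t h0 h1 => ?_⟩
  have hf := W.f_pos ξ t h0 h1
  have hg := W.g_pos ξ t h0 h1
  have hfg := f_le_g W sol.init_order ξ t h0 h1
  have hpin := f_pinched W (1 - ε) (by linarith) hε3 ξ t h0 h1
  have hh := h_bound sol B 0 t le_rfl h0 h1 (fun x => hB ⟨x, rfl⟩) ξ
  have hnn : 0 ≤ 1 / f ξ t - 1 / g ξ t := sub_nonneg.mpr (one_div_le_one_div_of_le hf hfg)
  have hB0 : 0 ≤ B := hnn.trans hh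
  refine ⟨hnn, hh.trans ?_, sub_nonneg.mpr hfg, ?_⟩
  · rw [le_div_iff₀ hc]; nlinarith
  · have hM : M f g ξ t = f ξ t := min_eq_left hfg
    rw [hM]
    have e : g ξ t - f ξ t = (1 / f ξ t - 1 / g ξ t) * (f ξ t * g ξ t) := by
      field_simp
    rw [e]
    calc (1 / f ξ t - 1 / g ξ t) * (f ξ t * g ξ t) ≤ B * (f ξ t * g ξ t) :=
          mul_le_mul_of_nonneg_right hh (by positivity)
      _ ≤ B * (f ξ t * (f ξ t / (1 - ε))) := by
          refine mul_le_mul_of_nonneg_left (mul_le_mul_of_nonneg_left ?_ hf.le) hB0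
          rw [le_div_iff₀ hc]; linarith
      _ = B / (1 - ε) * f ξ t ^ 2 := by ring
end
end
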